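/- arXiv:1504.02250 — 2 statements merged into one kernel-verified Lean document; each statement's English description precedes it below -/
import Mathlib

section
/- Let M be a maximum matching in a bipartite graph G. If every maximum matching in G is uniquely restricted, then the induced subgraphs G[V^+(M)] and G[V^-(M)] are forests. -/
variable {V : Type*}

/-- `M` is a matching in `G`: a set of edges of `G` that are pairwise disjoint. -/
def IsMatchingSet (G : SimpleGraph V) (M : Set (Sym2 V)) : Prop :=
  M ⊆ G.edgeSet ∧ ∀ e ∈ M, ∀ f ∈ M, e ≠ f → ∀ v : V, v ∈ e → v ∉ f

/-- `V(M)`: the set of vertices covered by the matching `M`. -/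
def matVerts (M : Set (Sym2 V)) : Set V := {v | ∃ e ∈ M, v ∈ e}

/-- `M` is a maximum matching in `G`. -/
def IsMaximumMatching (G : SimpleGraph V) (M : Set (Sym2 V)) : Prop :=
  IsMatchingSet G M ∧ ∀ M', IsMatchingSet G M' → M'.ncard ≤ M.ncard

/-- `M` is uniquely restricted: no matching distinct from `M` covers the same vertices. -/
def UniquelyRestricted (G : SimpleGraph V) (M : Set (Sym2 V)) : Prop :=
  ∀ M', IsMatchingSet G M' → matVerts M' = matVerts M → M' = M

/-- `M` is a perfect matching of `G`. -/
def IsPerfectMatchingSet (G : SimpleGraph V) (M : Set (Sym2 V)) : Prop :=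
  IsMatchingSet G M ∧ matVerts M = Set.univ

/-- `A, B` form a bipartition of `G`. -/
def IsBipartition (G : SimpleGraph V) (A B : Set V) : Prop :=
  Disjoint A B ∧ A ∪ B = Set.univ ∧
    ∀ ⦃u v : V⦄, G.Adj u v → (u ∈ A ∧ v ∈ B) ∨ (u ∈ B ∧ v ∈ A)

/-- `I` is an independent set in `G`. -/
def IsIndepSet (G : SimpleGraph V) (I : Set V) : Prop :=
  ∀ u ∈ I, ∀ v ∈ I, ¬ G.Adj u v

/-- `I` is a maximum independent set in `G`. -/
def IsMaximumIndepSet (G : SimpleGraph V) (I : Set V) : Prop :=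
  IsIndepSet G I ∧ ∀ J, IsIndepSet G J → J.ncard ≤ I.ncard

/-- The arcs of the digraph `D(M)`: edges not in `M` oriented from `A` to `B`,
edges of `M` oriented from `B` to `A`. -/
def DMarc (G : SimpleGraph V) (A B : Set V) (M : Set (Sym2 V)) (u v : V) : Prop :=
  G.Adj u v ∧ ((u ∈ A ∧ v ∈ B ∧ s(u, v) ∉ M) ∨ (u ∈ B ∧ v ∈ A ∧ s(u, v) ∈ M))

/-- The digraph `D(M)` is acyclic. -/
def DMAcyclic (G : SimpleGraph V) (A B : Set V) (M : Set (Sym2 V)) : Prop :=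
  ∀ v : V, ¬ Relation.TransGen (DMarc G A B M) v v

/-- `V⁺(M)`: vertices reachable in `D(M)` from an `A`-vertex uncovered by `M`. -/
def Vplus (G : SimpleGraph V) (A B : Set V) (M : Set (Sym2 V)) : Set V :=
  {v | ∃ a ∈ A, a ∉ matVerts M ∧ Relation.ReflTransGen (DMarc G A B M) a v}

/-- `V⁻(M)`: vertices from which a `B`-vertex uncovered by `M` is reachable in `D(M)`. -/
def Vminus (G : SimpleGraph V) (A B : Set V) (M : Set (Sym2 V)) : Set V :=
  {v | ∃ b ∈ B, b ∉ matVerts M ∧ Relation.ReflTransGen (DMarc G A B M) v b}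

/-- Given a linear ordering `l` of an independent set, `Mσ G l` is the set of edges
`y·p(y)` where `p(y)` is the first vertex of `l` adjacent to `y`. -/
def Msigma (G : SimpleGraph V) (l : List V) : Set (Sym2 V) :=
  {e | ∃ (i : Fin l.length) (y : V), e = s(y, l.get i) ∧ G.Adj (l.get i) y ∧
      ∀ j : Fin l.length, (j : ℕ) < (i : ℕ) → ¬ G.Adj (l.get j) y}

/-- `l` is an accessibility ordering of `I`: it enumerates `I` without repetition
and `Mσ` is a matching. -/
def IsAccessibilityOrdering (G : SimpleGraph V) (I : Set V) (l : List V) : Prop :=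
  l.Nodup ∧ {v | v ∈ l} = I ∧ IsMatchingSet G (Msigma G l)

/-- A partial accessibility ordering: an accessibility ordering of a subset of `I`. -/
def IsPartialAccessibilityOrdering (G : SimpleGraph V) (I : Set V) (l : List V) : Prop :=
  l.Nodup ∧ {v | v ∈ l} ⊆ I ∧ IsMatchingSet G (Msigma G l)

/-- `c` is an `M`-alternating cycle: of every two adjacent edges exactly one is in `M`. -/
def IsAlternatingCycle (G : SimpleGraph V) (M : Set (Sym2 V)) {v : V} (c : G.Walk v v) : Prop :=
  c.IsCycle ∧ (c.edges ++ c.edges.take 1).Chain' (fun e f => e ∈ M ↔ f ∉ M)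

/-- `M'` arises from `M` by a single edge exchange. -/
def EdgeExchange (G : SimpleGraph V) (A B : Set V) (M M' : Set (Sym2 V)) : Prop :=
  (∃ a a' b' : V, a ∈ A ∧ a ∉ matVerts M ∧ s(a', b') ∈ M ∧ G.Adj a b' ∧
      M' = (M \ {s(a', b')}) ∪ {s(a, b')}) ∨
  (∃ b a' b' : V, b ∈ B ∧ b ∉ matVerts M ∧ s(a', b') ∈ M ∧ G.Adj a' b ∧
      M' = (M \ {s(a', b')}) ∪ {s(a', b)})

section HallForest

variable [DecidableEq V]

theorem exists_injOn_mem_of_card_le {T : Finset V} (t : V → Finset V)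
    (h : ∀ X ⊆ T, X.card ≤ (X.biUnion t).card) :
    ∃ f : V → V, Set.InjOn f T ∧ ∀ u ∈ T, f u ∈ t u := by
  obtain ⟨f, hf, hft⟩ := (Finset.all_card_le_biUnion_card_iff_exists_injective
    (fun u : T => t u)).1 (fun X => by
      have := h (X.map (Function.Embedding.subtype _)) (by
        intro x hx
        simp only [Finset.mem_map, Function.Embedding.subtype_apply] at hx
        obtain ⟨y, -, rfl⟩ := hx
        exact y.2)
      rw [Finset.card_map] at this
      refine this.trans (Finset.card_le_card ?_)
      intro x hx
      simp only [Finset.mem_biUnion, Finset.mem_map, Function.Embedding.subtype_apply] at hx ⊢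
      obtain ⟨_, ⟨y, hy, rfl⟩, hx⟩ := hx
      exact ⟨y, hy, hx⟩)
  refine ⟨fun v => if hv : v ∈ T then f ⟨v, hv⟩ else v, ?_, ?_⟩
  · intro x hx y hy hxy
    rw [Finset.mem_coe] at hx hy
    simp only [hx, hy, dif_pos] at hxy
    simpa using hf hxy
  · intro u hu
    simp only [hu, dif_pos]
    exact hft ⟨u, hu⟩

/-- If every choice function `f` for the sets `N u`, `u ∈ T`, admits no alternating cycle and all
these sets have at least two elements, then the incidence graph of `N` on `T` is a forest,
expressed as a counting condition on its subgraphs. -/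
theorem card_lt_card_biUnion_of_forall_injOn (N : V → Finset V) (T : Finset V)
    (hdeg : ∀ u ∈ T, 2 ≤ (N u).card) (f₀ : V → V) (hinj : Set.InjOn f₀ T)
    (hmem : ∀ u ∈ T, f₀ u ∈ N u)
    (hac : ∀ f : V → V, Set.InjOn f T → (∀ u ∈ T, f u ∈ N u) → ∀ S ⊆ T, S.Nonempty →
      ∃ b ∈ S, ∀ b' ∈ S, f b ∈ N b' → b' = b)
    (N' : V → Finset V) (S : Finset V) (hST : S ⊆ T) (hS : S.Nonempty)
    (hN' : ∀ u ∈ S, N' u ⊆ N u ∧ 2 ≤ (N' u).card) :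
    S.card < (S.biUnion N').card := by
  induction T using Finset.strongInduction generalizing N' S with
  | H T IH =>
  induction S using Finset.strongInduction with
  | H S IHS =>
  by_contra! hle
  obtain ⟨b, hbT, hb⟩ := hac f₀ hinj hmem T subset_rfl (hS.mono hST)
  have good := IH (T.erase b) (Finset.erase_ssubset hbT)
    (fun u hu => hdeg u (Finset.mem_of_mem_erase hu))
    (hinj.mono (by simp))
    (fun u hu => hmem u (Finset.mem_of_mem_erase hu)) (by
      intro f hf hfN R hR hRne
      have hval : ∀ u ∈ T.erase b, Function.update f b (f₀ b) u = f u := fun u hu =>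
        Function.update_of_ne (Finset.ne_of_mem_erase hu) _ _
      have hne : ∀ u ∈ T.erase b, f u ≠ f₀ b := fun u hu h =>
        Finset.ne_of_mem_erase hu (hb u (Finset.mem_of_mem_erase hu) (h ▸ hfN u hu))
      obtain ⟨c, hc, hc'⟩ := hac (Function.update f b (f₀ b)) (by
          intro x hx y hy hxy
          rw [Finset.mem_coe] at hx hy
          by_cases hxb : x = b <;> by_cases hyb : y = b
          · rw [hxb, hyb]
          · subst hxb
            have hy' := Finset.mem_erase.2 ⟨hyb, hy⟩
            rw [Function.update_self, hval y hy'] at hxy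
            exact absurd hxy.symm (hne y hy')
          · subst hyb
            have hx' := Finset.mem_erase.2 ⟨hxb, hx⟩
            rw [Function.update_self, hval x hx'] at hxy
            exact absurd hxy (hne x hx')
          · have hx' := Finset.mem_erase.2 ⟨hxb, hx⟩
            have hy' := Finset.mem_erase.2 ⟨hyb, hy⟩
            rw [hval x hx', hval y hy'] at hxy
            exact hf hx' hy' hxy) (by
          intro u hu
          by_cases hub : u = b
          · subst hub
            rw [Function.update_self]
            exact hmem u hu
          · have hu' := Finset.mem_erase.2 ⟨hub, hu⟩
            rw [hval u hu']
            exact hfN u hu') R (hR.trans (Finset.erase_subset _ _)) hRne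
      refine ⟨c, hc, fun b' hb' h => hc' b' hb' ?_⟩
      rwa [hval c (hR hc)])
  by_cases hbS : b ∈ S
  swap
  · exact hle.not_gt (good N' S (fun x hx => Finset.mem_erase.2
      ⟨fun h => hbS (h ▸ hx), hST hx⟩) hS hN')
  have hcard := Finset.card_erase_add_one hbS
  have hS'T : S.erase b ⊆ T.erase b := Finset.erase_subset_erase _ hST
  rcases (S.erase b).eq_empty_or_nonempty with hS' | hS'
  · have h2 := (hN' b hbS).2
    have := Finset.card_le_card (Finset.subset_biUnion_of_mem N' hbS)
    rw [hS', Finset.card_empty] at hcard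
    omega
  have hgood := good N' _ hS'T hS' (fun u hu => hN' u (Finset.mem_of_mem_erase hu))
  have hmono := Finset.card_le_card
    (Finset.biUnion_subset_biUnion_of_subset_left N' (Finset.erase_subset b S))
  set Y := S.biUnion N' with hY
  have hYS : Y.card = S.card := by omega
  have hW : ∀ W ⊆ S, W.card ≤ (W.biUnion N').card := by
    intro W hW
    rcases W.eq_empty_or_nonempty with rfl | hWne
    · simp
    rcases hW.eq_or_ssubset with rfl | hWS
    · exact hYS.ge
    · exact (IHS W hWS (hW.trans hST) hWne fun u hu => hN' u (hW hu)).le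
  have hU : ∀ U ⊆ T \ S, U.card ≤ (U.biUnion N \ Y).card := by
    intro U hU
    by_contra! hlt
    have hUS : ∀ u ∈ U, u ∉ S := fun u hu => (Finset.mem_sdiff.1 (hU hu)).2
    have hdisj : Disjoint U (S.erase b) := Finset.disjoint_left.2 fun u hu hu' =>
      hUS u hu (Finset.mem_of_mem_erase hu')
    have h1 := good (fun u => if u ∈ S then N' u else N u) (U ∪ S.erase b) (by
        refine Finset.union_subset (fun u hu => Finset.mem_erase.2 ⟨?_, ?_⟩) hS'T
        · rintro rfl
          exact hUS _ hu hbS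
        · exact (Finset.mem_sdiff.1 (hU hu)).1)
      (hS'.mono Finset.subset_union_right) (by
        intro u hu
        by_cases huS : u ∈ S
        · simpa [huS] using hN' u huS
        · have : u ∈ U := (Finset.mem_union.1 hu).resolve_right
            fun h => huS (Finset.mem_of_mem_erase h)
          simpa [huS] using hdeg u (Finset.mem_sdiff.1 (hU this)).1)
    have h2 : (U ∪ S.erase b).biUnion (fun u => if u ∈ S then N' u else N u) ⊆
        Y ∪ (U.biUnion N \ Y) := by
      rw [Finset.union_sdiff_self_eq_union]
      intro x hx
      obtain ⟨u, hu, hx⟩ := Finset.mem_biUnion.1 hx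
      by_cases huS : u ∈ S
      · rw [if_pos huS] at hx
        exact Finset.mem_union_left _ (Finset.mem_biUnion.2 ⟨u, huS, hx⟩)
      · rw [if_neg huS] at hx
        have : u ∈ U := (Finset.mem_union.1 hu).resolve_right
          fun h => huS (Finset.mem_of_mem_erase h)
        exact Finset.mem_union_right _ (Finset.mem_biUnion.2 ⟨u, this, hx⟩)
    have h3 := (Finset.card_le_card h2).trans (Finset.card_union_le _ _)
    rw [Finset.card_union_of_disjoint hdisj] at h1
    omega
  obtain ⟨f, hf, hft⟩ := exists_injOn_mem_of_card_le (T := T)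
      (fun u => if u ∈ S then N' u else N u \ Y) (by
    intro X hX
    have e1 : X.card = (X ∩ S).card + (X \ S).card := (Finset.card_inter_add_card_sdiff X S).symm
    have e2 : Disjoint ((X ∩ S).biUnion N') ((X \ S).biUnion N \ Y) := by
      refine Finset.disjoint_of_subset_left ?_ Finset.disjoint_sdiff
      exact Finset.biUnion_subset_biUnion_of_subset_left _ Finset.inter_subset_right
    have e3 := hW (X ∩ S) Finset.inter_subset_right
    have e4 := hU (X \ S) (Finset.sdiff_subset_sdiff hX subset_rfl)
    rw [e1]
    refine (add_le_add e3 e4).trans ?_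
    rw [← Finset.card_union_of_disjoint e2]
    refine Finset.card_le_card ?_
    intro x hx
    simp only [Finset.mem_union, Finset.mem_biUnion, Finset.mem_sdiff, Finset.mem_inter] at hx ⊢
    rcases hx with ⟨u, ⟨huX, huS⟩, hx⟩ | ⟨⟨u, ⟨huX, huS⟩, hx⟩, hxY⟩
    · exact ⟨u, huX, by simpa [huS] using hx⟩
    · exact ⟨u, huX, by simpa [huS] using ⟨hx, hxY⟩⟩)
  have hfS : ∀ u ∈ S, f u ∈ N' u := fun u hu => by simpa [hu] using hft u (hST hu)
  obtain ⟨c, hcS, hc⟩ := hac f hf (by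
    intro u hu
    by_cases huS : u ∈ S
    · exact (hN' u huS).1 (hfS u huS)
    · have := hft u hu
      rw [if_neg huS] at this
      exact (Finset.mem_sdiff.1 this).1) S hST hS
  have hccard := Finset.card_erase_add_one hcS
  have hcne : (S.erase c).Nonempty := by
    rw [← Finset.card_pos] at hS' ⊢
    omega
  have h1 := IHS (S.erase c) (Finset.erase_ssubset hcS) ((Finset.erase_subset _ _).trans hST) hcne
    fun u hu => hN' u (Finset.mem_of_mem_erase hu)
  have hcY : f c ∈ Y := Finset.mem_biUnion.2 ⟨c, hcS, hfS c hcS⟩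
  have h2 : (S.erase c).biUnion N' ⊆ Y.erase (f c) := by
    intro x hx
    obtain ⟨u, hu, hx⟩ := Finset.mem_biUnion.1 hx
    obtain ⟨huc, huS⟩ := Finset.mem_erase.1 hu
    refine Finset.mem_erase.2 ⟨?_, Finset.mem_biUnion.2 ⟨u, huS, hx⟩⟩
    rintro rfl
    exact huc (hc u huS ((hN' u huS).1 hx))
  have h3 := Finset.card_le_card h2
  have h4 := Finset.card_erase_add_one hcY
  omega

/-- A choice function with an alternating cycle inside `S` can be rotated along it. -/
theorem exists_bijOn_ne_of_forall_exists_ne {N : V → Finset V} {T : Finset V} {f : V → V}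
    (hmem : ∀ u ∈ T, f u ∈ N u) (S : Finset V) (hST : S ⊆ T) (hS : S.Nonempty)
    (h : V → V) (hh : ∀ b ∈ S, h b ∈ S ∧ f b ∈ N (h b) ∧ h b ≠ b) :
    ∃ ρ : V → V, Set.BijOn ρ T T ∧ (∀ u ∈ T, f (ρ u) ∈ N u) ∧ ∃ u ∈ T, ρ u ≠ u := by
  induction S using Finset.strongInduction with
  | H S IH =>
  have himg : S.image h ⊆ S := Finset.image_subset_iff.2 fun b hb => (hh b hb).1
  rcases himg.eq_or_ssubset with heq | hss
  swap
  · exact IH _ hss (himg.trans hST) (hS.image h) fun b hb =>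
      ⟨Finset.mem_image_of_mem h (himg hb), (hh b (himg hb)).2⟩
  have hinv : ∀ u ∈ S, ∃ b ∈ S, h b = u := fun u hu => Finset.mem_image.1 (heq.symm ▸ hu)
  choose! k hkS hk using hinv
  have hinj : Set.InjOn (fun u => if u ∈ S then k u else u) T := by
    intro x hx y hy hxy
    by_cases hxS : x ∈ S <;> by_cases hyS : y ∈ S <;> simp only [hxS, hyS, if_true, if_false] at hxy
    · rw [← hk x hxS, hxy, hk y hyS]
    · exact absurd (hxy ▸ hkS x hxS) hyS
    · exact absurd (hxy ▸ hkS y hyS) hxS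
    · exact hxy
  have hmaps : Set.MapsTo (fun u => if u ∈ S then k u else u) T T := by
    intro x hx
    by_cases hxS : x ∈ S
    · simpa [hxS] using hST (hkS x hxS)
    · simpa [hxS] using hx
  refine ⟨fun u => if u ∈ S then k u else u,
    ⟨hmaps, hinj, Finset.surjOn_of_injOn_of_card_le _ hmaps hinj le_rfl⟩, ?_, ?_⟩
  · intro u hu
    by_cases huS : u ∈ S
    · have := (hh (k u) (hkS u huS)).2.1
      rw [hk u huS] at this
      simpa [huS] using this
    · simpa [huS] using hmem u hu
  · obtain ⟨u, hu⟩ := hS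
    refine ⟨u, hST hu, fun he => ?_⟩
    simp only [hu, if_true] at he
    have := (hh (k u) (hkS u hu)).2.2
    rw [hk u hu, he] at this
    exact this rfl

end HallForest

section Matching

variable {G : SimpleGraph V} {A B : Set V} {M : Set (Sym2 V)}

theorem IsMatchingSet.mono {M' : Set (Sym2 V)} (hM : IsMatchingSet G M) (h : M' ⊆ M) :
    IsMatchingSet G M' :=
  ⟨h.trans hM.1, fun e he f hf => hM.2 e (h he) f (h hf)⟩

theorem matVerts_mono {M' : Set (Sym2 V)} (h : M' ⊆ M) : matVerts M' ⊆ matVerts M :=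
  fun _ ⟨e, he, hv⟩ => ⟨e, h he, hv⟩

theorem IsMatchingSet.eq_of_mem (hM : IsMatchingSet G M) {e f : Sym2 V} (he : e ∈ M) (hf : f ∈ M)
    {v : V} (hve : v ∈ e) (hvf : v ∈ f) : e = f :=
  by_contra fun h => hM.2 e he f hf h v hve hvf

theorem IsMatchingSet.eq_right (hM : IsMatchingSet G M) {u v w : V} (hv : s(u, v) ∈ M)
    (hw : s(u, w) ∈ M) : v = w :=
  Sym2.congr_right.1 (hM.eq_of_mem hv hw (Sym2.mem_mk_left u v) (Sym2.mem_mk_left u w))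

theorem IsMatchingSet.insert (hM : IsMatchingSet G M) {u v : V} (huv : G.Adj u v)
    (hu : u ∉ matVerts M) (hv : v ∉ matVerts M) : IsMatchingSet G (insert s(u, v) M) := by
  have key : ∀ e ∈ M, ∀ x ∈ s(u, v), x ∉ e := by
    intro e he x hx hxe
    rcases Sym2.mem_iff.1 hx with rfl | rfl
    · exact hu ⟨e, he, hxe⟩
    · exact hv ⟨e, he, hxe⟩
  refine ⟨Set.insert_subset huv hM.1, ?_⟩
  rintro e (rfl | he) f (rfl | hf) hef x hx hxf
  · exact hef rfl
  · exact key f hf x hx hxf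
  · exact key e he x hxf hx
  · exact hM.2 e he f hf hef x hx hxf

theorem IsMatchingSet.notMem_matVerts_sdiff (hM : IsMatchingSet G M) {e : Sym2 V} (he : e ∈ M)
    {v : V} (hv : v ∈ e) : v ∉ matVerts (M \ {e}) :=
  fun ⟨_, hf, hvf⟩ => hf.2 (hM.eq_of_mem hf.1 he hvf hv)

theorem notMem_of_notMem_matVerts {u v : V} (hu : u ∉ matVerts M) : s(u, v) ∉ M :=
  fun h => hu ⟨_, h, Sym2.mem_mk_left u v⟩

theorem IsBipartition.symm (h : IsBipartition G A B) : IsBipartition G B A :=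
  ⟨h.1.symm, by rw [Set.union_comm, h.2.1], fun _ _ huv => (h.2.2 huv).symm⟩

theorem reflTransGen_avoiding {α : Type*} {r : α → α → Prop} {x c : α}
    (h : Relation.ReflTransGen r x c) {z : α} (hz : z ≠ c) :
    (x ≠ z ∧ Relation.ReflTransGen (fun x y => r x y ∧ x ≠ z ∧ y ≠ z) x c) ∨
      ∃ y, r z y ∧ y ≠ z ∧ Relation.ReflTransGen (fun x y => r x y ∧ x ≠ z ∧ y ≠ z) y c := by
  induction h using Relation.ReflTransGen.head_induction_on with
  | refl => exact Or.inl ⟨hz.symm, .refl⟩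
  | @head x y hxy _ ih =>
    rcases ih with ⟨hy, ih⟩ | ih
    · by_cases hx : x = z
      · subst hx
        exact Or.inr ⟨y, hxy, hy, ih⟩
      · exact Or.inl ⟨hx, .head ⟨hxy, hx, hy⟩ ih⟩
    · exact Or.inr ih

/-- A maximum matching has no augmenting path. -/
theorem IsMaximumMatching.not_reflTransGen [Fintype V] (hbip : IsBipartition G A B)
    (W : Finset V) (hM : IsMaximumMatching G M) {a b : V} (ha : a ∈ A) (haM : a ∉ matVerts M)
    (haW : a ∈ W) (hb : b ∈ B) (hbM : b ∉ matVerts M) :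
    ¬ Relation.ReflTransGen (fun x y => DMarc G A B M x y ∧ x ∈ W ∧ y ∈ W) a b := by
  classical
  induction W using Finset.strongInduction generalizing M a with
  | H W IH =>
  intro hab
  have hne : a ≠ b := hbip.1.ne_of_mem ha hb
  obtain ⟨c, ⟨⟨hac, harc⟩, -, hcW⟩, hca, hcb⟩ :=
    (reflTransGen_avoiding hab hne).resolve_left fun h => h.1 rfl
  have hcB : c ∈ B := by
    rcases harc with h | h
    · exact h.2.1
    · exact absurd rfl (hbip.1.ne_of_mem ha h.1)
  by_cases hcM : c ∈ matVerts M
  swap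
  · have h1 := hM.2 _ (hM.1.insert hac haM hcM)
    rw [Set.ncard_insert_of_notMem (notMem_of_notMem_matVerts haM)] at h1
    omega
  have hcb' : c ≠ b := fun h => hbM (h ▸ hcM)
  obtain ⟨d, ⟨⟨⟨hcd, harc'⟩, -, hdW⟩, -, hda⟩, hdc, hdb⟩ :=
    (reflTransGen_avoiding hcb hcb').resolve_left fun h => h.1 rfl
  obtain ⟨-, hdA, hcdM⟩ : c ∈ B ∧ d ∈ A ∧ s(c, d) ∈ M :=
    harc'.resolve_left fun h => absurd rfl (hbip.1.ne_of_mem h.1 hcB)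
  have ha' : a ∉ matVerts (M \ {s(c, d)}) := fun h => haM (matVerts_mono Set.sdiff_subset h)
  have hc' := hM.1.notMem_matVerts_sdiff hcdM (Sym2.mem_mk_left c d)
  have hd' := hM.1.notMem_matVerts_sdiff hcdM (Sym2.mem_mk_right c d)
  have hM' : IsMaximumMatching G (insert s(a, c) (M \ {s(c, d)})) := by
    refine ⟨(hM.1.mono Set.sdiff_subset).insert hac ha' hc', fun M' hM' => ?_⟩
    rw [Set.ncard_insert_of_notMem (notMem_of_notMem_matVerts ha'),
      Set.ncard_sdiff_singleton_add_one hcdM]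
    exact hM.2 M' hM'
  refine IH (W.erase a) (Finset.erase_ssubset haW) hM' hdA ?_ (Finset.mem_erase.2 ⟨hda, hdW⟩)
    ?_ ?_
  · rintro ⟨e, rfl | he, hde⟩
    · rcases Sym2.mem_iff.1 hde with h | h
      · exact hda h
      · exact hdc h
    · exact hd' ⟨e, he, hde⟩
  · rintro ⟨e, rfl | he, hbe⟩
    · rcases Sym2.mem_iff.1 hbe with h | h
      · exact hne h.symm
      · exact hcb' h.symm
    · exact hbM ⟨e, he.1, hbe⟩
  · refine Relation.ReflTransGen.mono ?_ _ _ hdb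
    rintro x y ⟨⟨⟨⟨hxy, h⟩, hxW, hyW⟩, hxa, hya⟩, hxc, hyc⟩
    refine ⟨⟨hxy, ?_⟩, Finset.mem_erase.2 ⟨hxa, hxW⟩, Finset.mem_erase.2 ⟨hya, hyW⟩⟩
    have hmem : s(x, y) ∈ insert s(a, c) (M \ {s(c, d)}) ↔ s(x, y) ∈ M := by
      have h1 : s(x, y) ≠ s(a, c) := by simp [hxa, hya]
      have h2 : s(x, y) ≠ s(c, d) := by simp [hxc, hyc]
      simp [h1, h2]
    rwa [hmem]

theorem IsMaximumMatching.mem_matVerts_of_mem_Vplus [Fintype V] (hbip : IsBipartition G A B)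
    (hM : IsMaximumMatching G M) {b : V} (hb : b ∈ B) (hbV : b ∈ Vplus G A B M) :
    b ∈ matVerts M := by
  by_contra hbM
  obtain ⟨a, ha, haM, hab⟩ := hbV
  exact hM.not_reflTransGen hbip Finset.univ ha haM (Finset.mem_univ a) hb hbM
    (by simpa using hab)

theorem mem_Vplus_of_arc {u v : V} (hu : u ∈ Vplus G A B M) (huv : DMarc G A B M u v) :
    v ∈ Vplus G A B M :=
  let ⟨a, ha, haM, h⟩ := hu
  ⟨a, ha, haM, h.tail huv⟩

theorem exists_arc_of_mem_Vplus {v : V} (hv : v ∈ Vplus G A B M) :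
    (v ∈ A ∧ v ∉ matVerts M) ∨ ∃ u ∈ Vplus G A B M, DMarc G A B M u v := by
  obtain ⟨a, ha, haM, h⟩ := hv
  rcases h.cases_tail with rfl | ⟨u, hau, huv⟩
  · exact Or.inl ⟨ha, haM⟩
  · exact Or.inr ⟨u, ⟨a, ha, haM, hau⟩, huv⟩

theorem Vminus_eq_Vplus_swap : Vminus G A B M = Vplus G B A M := by
  have hswap : Function.swap (DMarc G A B M) = DMarc G B A M := by
    ext u v
    simp only [Function.swap, DMarc, Sym2.eq_swap (a := v) (b := u), G.adj_comm v u]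
    tauto
  ext v
  simp only [Vminus, Vplus, Set.mem_ofPred_eq, ← hswap, Relation.reflTransGen_swap]

/-- The matching obtained from `M` by rematching the vertices `u ∈ T` with `f u`. -/
def rematch (M : Set (Sym2 V)) (T : Set V) (f : V → V) : Set (Sym2 V) :=
  {e ∈ M | ∀ v ∈ e, v ∉ T} ∪ (fun u => s(u, f u)) '' T

theorem mem_matVerts_rematch {T : Set V} {f : V → V} {v : V} :
    v ∈ matVerts (rematch M T f) ↔
      v ∈ matVerts {e ∈ M | ∀ v ∈ e, v ∉ T} ∨ v ∈ T ∨ v ∈ f '' T := by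
  constructor
  · rintro ⟨e, he | ⟨u, hu, rfl⟩, hv⟩
    · exact Or.inl ⟨e, he, hv⟩
    · rcases Sym2.mem_iff.1 hv with rfl | rfl
      · exact Or.inr (Or.inl hu)
      · exact Or.inr (Or.inr ⟨u, hu, rfl⟩)
  · rintro (⟨e, he, hv⟩ | hv | ⟨u, hu, rfl⟩)
    · exact ⟨e, Or.inl he, hv⟩
    · exact ⟨_, Or.inr ⟨v, hv, rfl⟩, Sym2.mem_mk_left _ _⟩
    · exact ⟨_, Or.inr ⟨u, hu, rfl⟩, Sym2.mem_mk_right _ _⟩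

/-- Rematching `B ∩ V⁺(M)` injectively into `A ∩ V⁺(M)` gives a maximum matching. -/
theorem IsMaximumMatching.rematch [Fintype V] (hbip : IsBipartition G A B)
    (hM : IsMaximumMatching G M) {f : V → V} (hf : Set.InjOn f (B ∩ Vplus G A B M))
    (hfA : ∀ u ∈ B ∩ Vplus G A B M, f u ∈ A ∩ Vplus G A B M ∧ G.Adj u (f u)) :
    IsMaximumMatching G (rematch M (B ∩ Vplus G A B M) f) := by
  set T := B ∩ Vplus G A B M with hT
  have hinj : Set.InjOn (fun u => s(u, f u)) T := by
    intro x hx y hy hxy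
    rcases Sym2.eq_iff.1 hxy with h | h
    · exact h.1
    · exact absurd h.1.symm (hbip.1.ne_of_mem (hfA y hy).1.1 hx.1)
  have hfree : ∀ e ∈ M, (∀ v ∈ e, v ∉ T) → ∀ u ∈ T, f u ∉ e := by
    intro e he heT u hu hue
    obtain ⟨hfu, -⟩ := hfA u hu
    rcases exists_arc_of_mem_Vplus hfu.2 with h | ⟨w, hw, -, h⟩
    · exact h.2 ⟨e, he, hue⟩
    · rcases h with h | h
      · exact absurd rfl (hbip.1.ne_of_mem hfu.1 h.2.1)
      · have := hM.1.eq_of_mem he h.2.2 hue (Sym2.mem_mk_right _ _)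
        exact heT w (this ▸ Sym2.mem_mk_left _ _) ⟨h.1, hw⟩
  have hcross : ∀ e ∈ M, (∀ v ∈ e, v ∉ T) → ∀ u ∈ T, ∀ v ∈ e, v ∉ s(u, f u) := by
    intro e he heT u hu v hv hvu
    rcases Sym2.mem_iff.1 hvu with rfl | rfl
    · exact heT _ hv hu
    · exact hfree e he heT u hu hv
  refine ⟨⟨?_, ?_⟩, fun M' hM' => (hM.2 M' hM').trans ?_⟩
  · rintro e (he | ⟨u, hu, rfl⟩)
    · exact hM.1.1 he.1
    · exact (hfA u hu).2
  · rintro e (he | ⟨u, hu, rfl⟩) e' (he' | ⟨u', hu', rfl⟩) hne v hv hv'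
    · exact hM.1.2 e he.1 e' he'.1 hne v hv hv'
    · exact hcross e he.1 he.2 u' hu' v hv hv'
    · exact hcross e' he'.1 he'.2 u hu v hv' hv
    · apply hne
      rcases Sym2.mem_iff.1 hv with rfl | rfl <;> rcases Sym2.mem_iff.1 hv' with h | h
      · rw [h]
      · exact absurd h.symm (hbip.1.ne_of_mem (hfA u' hu').1.1 hu.1)
      · exact absurd h (hbip.1.ne_of_mem (hfA u hu).1.1 hu'.1)
      · rw [hf hu hu' h]
  · have hdisj : Disjoint {e ∈ M | ∀ v ∈ e, v ∉ T} ((fun u => s(u, f u)) '' T) := by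
      refine Set.disjoint_left.2 ?_
      rintro _ he ⟨u, hu, rfl⟩
      exact he.2 u (Sym2.mem_mk_left _ _) hu
    have hsplit : M = {e ∈ M | ∀ v ∈ e, v ∉ T} ∪ {e ∈ M | ∃ v ∈ e, v ∈ T} := by
      ext e
      by_cases h : ∃ v ∈ e, v ∈ T
      · simp [h]
      · have : ∀ v ∈ e, v ∉ T := fun v hv hvT => h ⟨v, hv, hvT⟩
        simpa [h] using fun _ => this
    have htouch : {e ∈ M | ∃ v ∈ e, v ∈ T}.ncard ≤ T.ncard := by
      have : ∀ e : Sym2 V, ∃ v, (∃ w ∈ e, w ∈ T) → v ∈ e ∧ v ∈ T := by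
        intro e
        by_cases h : ∃ w ∈ e, w ∈ T
        · exact h.imp fun w hw _ => hw
        · exact ⟨e.out.1, fun h' => absurd h' h⟩
      choose g hg using this
      refine Set.ncard_le_ncard_of_injOn g (fun e he => (hg e he.2).2) ?_
      intro e he e' he' h
      exact hM.1.eq_of_mem he.1 he'.1 (hg e he.2).1 (h ▸ (hg e' he'.2).1)
    have h1 : M.ncard ≤ _ := (congrArg Set.ncard hsplit).le.trans (Set.ncard_union_le _ _)
    rw [_root_.rematch, Set.ncard_union_eq hdisj, hinj.ncard_image]
    omega

end Matching

section Forest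

variable {G : SimpleGraph V} {A B : Set V} {M : Set (Sym2 V)}

theorem not_isCycle_of_support_subset_Vplus [Fintype V] (hbip : IsBipartition G A B)
    (hM : IsMaximumMatching G M)
    (hur : ∀ M', IsMaximumMatching G M' → UniquelyRestricted G M') {x₀ : V} (p : G.Walk x₀ x₀)
    (hpV : ∀ v ∈ p.support, v ∈ Vplus G A B M) : ¬ p.IsCycle := by
  classical
  intro hpc
  have hHV : ∀ v w, p.toSubgraph.Adj v w → v ∈ p.support := fun v w h =>
    p.mem_verts_toSubgraph.1 h.fst_mem
  let N : V → Finset V := fun b => {a | a ∈ A ∧ a ∈ Vplus G A B M ∧ G.Adj b a}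
  let N' : V → Finset V := fun b => {a | p.toSubgraph.Adj b a}
  let T : Finset V := {b | b ∈ B ∧ b ∈ Vplus G A B M}
  let S : Finset V := {b | b ∈ B ∧ b ∈ p.support}
  let Y : Finset V := {a | a ∈ A ∧ a ∈ p.support}
  have hAB : ∀ v ∈ A, v ∉ B := fun v hA hB => hbip.1.ne_of_mem hA hB rfl
  have hadjB : ∀ {u v}, G.Adj u v → u ∈ B → v ∈ A := fun {u v} huv hu =>
    (hbip.2.2 huv).elim (fun h => absurd hu (hAB u h.1)) fun h => h.2
  have hadjA : ∀ {u v}, G.Adj u v → u ∈ A → v ∈ B := fun {u v} huv hu =>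
    (hbip.2.2 huv).elim (fun h => h.2) fun h => absurd h.1 (hAB u hu)
  have hTcoe : (T : Set V) = B ∩ Vplus G A B M := by
    ext v
    simp [T]
  have hdegN' : ∀ v ∈ p.support, (N' v).card = 2 := by
    intro v hv
    rw [← hpc.ncard_neighborSet_toSubgraph_eq_two hv, ← Set.ncard_coe_finset]
    congr 1
    ext w
    simp [N']
  have hcard : S.card * 2 = Y.card * 2 := by
    refine Finset.card_mul_eq_card_mul p.toSubgraph.Adj ?_ ?_
    · intro b hb
      obtain ⟨hbB, hbp⟩ : b ∈ B ∧ b ∈ p.support := by simpa [S] using hb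
      rw [← hdegN' b hbp]
      congr 1
      ext a
      simp only [Finset.mem_bipartiteAbove, Finset.mem_filter_univ, Y, N', and_iff_right_iff_imp]
      exact fun h => ⟨hadjB h.adj_sub hbB, hHV a b h.symm⟩
    · intro a ha
      obtain ⟨haA, hap⟩ : a ∈ A ∧ a ∈ p.support := by simpa [Y] using ha
      rw [← hdegN' a hap]
      congr 1
      ext b
      simp only [Finset.mem_bipartiteBelow, Finset.mem_filter_univ, S, N']
      exact ⟨fun h => h.2.symm, fun h => ⟨⟨hadjA h.adj_sub haA, hHV b a h.symm⟩, h.symm⟩⟩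
  have hSne : S.Nonempty := by
    by_contra hS
    have hx : x₀ ∈ Y := by
      have : x₀ ∈ A ∪ B := hbip.2.1 ▸ Set.mem_univ _
      rcases this with h | h
      · simpa [Y] using h
      · exact absurd ⟨x₀, by simpa [S] using h⟩ hS
    have := Finset.card_pos.2 ⟨_, hx⟩
    rw [Finset.not_nonempty_iff_eq_empty.1 hS, Finset.card_empty] at hcard
    omega
  have hmate : ∀ u ∈ T, ∃ a ∈ N u, s(u, a) ∈ M := by
    intro u hu
    obtain ⟨huB, huV⟩ : u ∈ B ∧ u ∈ Vplus G A B M := by simpa [T] using hu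
    obtain ⟨e, he, hue⟩ := hM.mem_matVerts_of_mem_Vplus hbip huB huV
    obtain ⟨a, rfl⟩ := hue
    have hadj : G.Adj u a := hM.1.1 he
    have haA := hadjB hadj huB
    refine ⟨a, ?_, he⟩
    simpa [N] using ⟨haA, mem_Vplus_of_arc huV ⟨hadj, Or.inr ⟨huB, haA, he⟩⟩, hadj⟩
  have : Nonempty V := ⟨x₀⟩
  choose! f₀ hf₀N hf₀M using hmate
  have hf₀ : Set.InjOn f₀ T := by
    intro x hx y hy hxy
    have h1 := hf₀M x hx
    have h2 := hf₀M y hy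
    rw [Sym2.eq_swap] at h1 h2
    rw [← hxy] at h2
    exact hM.1.eq_right h1 h2
  have hdeg : ∀ u ∈ T, 2 ≤ (N u).card := by
    intro u hu
    obtain ⟨huB, huV⟩ : u ∈ B ∧ u ∈ Vplus G A B M := by simpa [T] using hu
    rcases exists_arc_of_mem_Vplus huV with h | ⟨w, hw, hwu, h⟩
    · exact absurd huB (hAB u h.1)
    rcases h with ⟨hwA, -, hwM⟩ | h
    · refine Finset.one_lt_card.2 ⟨w, ?_, f₀ u, hf₀N u hu, ?_⟩
      · simpa [N] using ⟨hwA, hw, hwu.symm⟩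
      · rintro rfl
        exact hwM (Sym2.eq_swap ▸ hf₀M u hu)
    · exact absurd huB (hAB u h.2.1)
  have hmax : ∀ f : V → V, Set.InjOn f T → (∀ u ∈ T, f u ∈ N u) →
      IsMaximumMatching G (rematch M T f) := by
    intro f hf hfN
    rw [hTcoe] at hf ⊢
    refine hM.rematch hbip hf fun u hu => ?_
    have := hfN u (Finset.mem_coe.1 (hTcoe ▸ hu))
    simpa [N, and_assoc] using this
  have hac : ∀ f : V → V, Set.InjOn f T → (∀ u ∈ T, f u ∈ N u) → ∀ R ⊆ T, R.Nonempty →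
      ∃ b ∈ R, ∀ b' ∈ R, f b ∈ N b' → b' = b := by
    intro f hf hfN R hRT hR
    by_contra! hcon
    choose! h hh using hcon
    obtain ⟨ρ, hρ, hρN, u, hu, hne⟩ := exists_bijOn_ne_of_forall_exists_ne hfN R hRT hR h hh
    have hfρ : Set.InjOn (f ∘ ρ) T := hf.comp hρ.injOn hρ.mapsTo
    have heq := hur _ (hmax f hf hfN) _ (hmax (f ∘ ρ) hfρ hρN).1 (by
      ext v
      rw [mem_matVerts_rematch, mem_matVerts_rematch, Set.image_comp, hρ.image_eq])
    have h1 : s(u, f u) ∈ rematch M T (f ∘ ρ) := heq ▸ Or.inr ⟨u, hu, rfl⟩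
    have h2 : s(u, f (ρ u)) ∈ rematch M T (f ∘ ρ) := Or.inr ⟨u, hu, rfl⟩
    exact hne (hf hu (hρ.mapsTo hu) ((hmax (f ∘ ρ) hfρ hρN).1.eq_right h1 h2)).symm
  have hlt := card_lt_card_biUnion_of_forall_injOn N T hdeg f₀ hf₀ hf₀N hac N' S (by
      intro b hb
      obtain ⟨hbB, hbp⟩ : b ∈ B ∧ b ∈ p.support := by simpa [S] using hb
      simpa [T] using ⟨hbB, hpV b hbp⟩) hSne (by
      intro b hb
      obtain ⟨hbB, hbp⟩ : b ∈ B ∧ b ∈ p.support := by simpa [S] using hb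
      refine ⟨fun a ha => ?_, (hdegN' b hbp).ge⟩
      have hba : p.toSubgraph.Adj b a := by simpa [N'] using ha
      simpa [N] using ⟨hadjB hba.adj_sub hbB, hpV a (hHV a b hba.symm), hba.adj_sub⟩)
  have hsub : S.biUnion N' ⊆ Y := by
    intro a ha
    obtain ⟨b, hb, hba⟩ := Finset.mem_biUnion.1 ha
    obtain ⟨hbB, hbp⟩ : b ∈ B ∧ b ∈ p.support := by simpa [S] using hb
    have hba : p.toSubgraph.Adj b a := by simpa [N'] using hba
    simpa [Y] using ⟨hadjB hba.adj_sub hbB, hHV a b hba.symm⟩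
  have := Finset.card_le_card hsub
  omega

theorem isAcyclic_induce_Vplus [Fintype V] (hbip : IsBipartition G A B)
    (hM : IsMaximumMatching G M)
    (hur : ∀ M', IsMaximumMatching G M' → UniquelyRestricted G M') :
    (G.induce (Vplus G A B M)).IsAcyclic := by
  intro x c hc
  refine not_isCycle_of_support_subset_Vplus hbip hM hur
    (c.map (SimpleGraph.Embedding.induce (Vplus G A B M)).toHom) ?_
    (hc.map Subtype.val_injective)
  intro v hv
  rw [SimpleGraph.Walk.support_map] at hv
  obtain ⟨y, -, rfl⟩ := List.mem_map.1 hv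
  exact y.2

end Forest

/-- If every maximum matching is uniquely restricted, then `G[V⁺(M)]` and `G[V⁻(M)]`
are forests. -/
theorem stmt10 [Fintype V] (G : SimpleGraph V) (A B : Set V) (hbip : IsBipartition G A B)
    (M : Set (Sym2 V)) (hM : IsMaximumMatching G M)
    (hur : ∀ M', IsMaximumMatching G M' → UniquelyRestricted G M') :
    (G.induce (Vplus G A B M)).IsAcyclic ∧ (G.induce (Vminus G A B M)).IsAcyclic := by
  exact ⟨isAcyclic_induce_Vplus hbip hM hur,
    Vminus_eq_Vplus_swap (G := G) (A := A) ▸ isAcyclic_induce_Vplus hbip.symm hM hur⟩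
end

section
/- Let G be a graph with Gallai–Edmonds decomposition D(G), A(G), C(G), and let G_B be the associated bipartite graph. Suppose: (i) every component of G[C(G)] has a unique perfect matching; (ii) G_B has a maximum matching M_B that is uniquely restricted and consists only of edges aH such that a has a unique neighbor h in V(H) and H − h has a unique perfect matching; (iii) every component H of G[D(G)] has a vertex h such that H − h has a unique perfect matching. Then some maximum matching in G is uniquely restricted. -/
variable {V : Type*}

/-- Gallai–Edmonds `D(G)`: vertices missed by some maximum matching. -/
def Dset (G : SimpleGraph V) : Set V :=
  {v | ∃ M, IsMaximumMatching G M ∧ v ∉ matVerts M}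

/-- Gallai–Edmonds `A(G)`: vertices outside `D(G)` with a neighbor in `D(G)`. -/
def Aset (G : SimpleGraph V) : Set V :=
  {v | v ∉ Dset G ∧ ∃ u ∈ Dset G, G.Adj v u}

/-- Gallai–Edmonds `C(G)`: the remaining vertices. -/
def Cset (G : SimpleGraph V) : Set V :=
  {v | v ∉ Dset G ∧ v ∉ Aset G}

/-- The vertex set of the connected component `H` of `G[S]`, as a subset of `V`. -/
def compSet (G : SimpleGraph V) (S : Set V) (H : (G.induce S).ConnectedComponent) : Set V :=
  {v | ∃ hv : v ∈ S, (G.induce S).connectedComponentMk ⟨v, hv⟩ = H}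

/-- The components of `G[D(G)]`. -/
abbrev DComp (G : SimpleGraph V) := (G.induce (Dset G)).ConnectedComponent

/-- The bipartite graph `G_B`: vertices are `A(G)` together with the components of
`G[D(G)]`; `a` is adjacent to a component `H` iff `a` has a neighbor in `V(H)`. -/
def GB (G : SimpleGraph V) : SimpleGraph (↥(Aset G) ⊕ DComp G) :=
  SimpleGraph.fromRel (fun x y => ∃ (a : ↥(Aset G)) (H : DComp G),
    x = Sum.inl a ∧ y = Sum.inr H ∧ ∃ d ∈ compSet G (Dset G) H, G.Adj a.1 d)

/-- `G[T] − h` has a unique perfect matching. -/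
def UniquePMminus (G : SimpleGraph V) (T : Set V) (h : V) : Prop :=
  ∃! N : Set (Sym2 ↥(T \ {h})), IsPerfectMatchingSet (G.induce (T \ {h})) N

/-- A matching of `G`, presented as the involution sending each covered vertex to its partner
and fixing every uncovered vertex. -/
def IsMatchingInvolution (G : SimpleGraph V) (f : V → V) : Prop :=
  Function.Involutive f ∧ ∀ x, f x ≠ x → G.Adj x (f x)

/-- The edges of the matching presented by an involution. -/
def involutionEdges (f : V → V) : Set (Sym2 V) := {e | ∃ x, f x ≠ x ∧ e = s(x, f x)}

/-- A matching involution with the least possible number of uncovered vertices. -/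
def IsOptimalInvolution (G : SimpleGraph V) (f : V → V) : Prop :=
  IsMatchingInvolution G f ∧ ∀ g, IsMatchingInvolution G g →
    (Function.fixedPoints f).ncard ≤ (Function.fixedPoints g).ncard

lemma mk_mem_involutionEdges {f : V → V} (hf : Function.Involutive f) {x y : V} :
    s(x, y) ∈ involutionEdges f ↔ x ≠ y ∧ f x = y := by
  constructor
  · rintro ⟨z, hz, h⟩
    rcases Sym2.eq_iff.1 h with ⟨rfl, rfl⟩ | ⟨rfl, rfl⟩
    · exact ⟨hz.symm, rfl⟩
    · exact ⟨hz, hf y⟩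
  · rintro ⟨h, rfl⟩
    exact ⟨x, h.symm, rfl⟩

lemma eq_of_involutionEdges_eq {f g : V → V} (hf : Function.Involutive f)
    (hg : Function.Involutive g) (h : involutionEdges f = involutionEdges g) : f = g := by
  have key : ∀ {f g : V → V}, Function.Involutive f → Function.Involutive g →
      involutionEdges f = involutionEdges g → ∀ x, f x ≠ x → g x = f x := by
    intro f g hf hg h x hx
    exact ((mk_mem_involutionEdges hg).1
      (h ▸ (mk_mem_involutionEdges hf).2 ⟨hx.symm, rfl⟩)).2
  funext x
  by_cases hx : f x = x
  · by_cases hx' : g x = x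
    · rw [hx, hx']
    · exact key hg hf h.symm x hx'
  · exact (key hf hg h x hx).symm

lemma mem_matVerts_involutionEdges {f : V → V} (hf : Function.Involutive f) {x : V} :
    x ∈ matVerts (involutionEdges f) ↔ f x ≠ x := by
  constructor
  · rintro ⟨e, ⟨y, hy, rfl⟩, hx⟩
    rcases Sym2.mem_iff.1 hx with rfl | rfl
    · exact hy
    · rw [hf y]; exact hy.symm
  · exact fun h => ⟨s(x, f x), ⟨x, h, rfl⟩, Sym2.mem_mk_left _ _⟩

lemma IsMatchingInvolution.isMatchingSet {G : SimpleGraph V} {f : V → V}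
    (hf : IsMatchingInvolution G f) : IsMatchingSet G (involutionEdges f) := by
  refine ⟨?_, ?_⟩
  · rintro e ⟨x, hx, rfl⟩
    exact hf.2 x hx
  · intro e he e' he' hne v hv hv'
    obtain ⟨y, rfl⟩ := Sym2.mem_iff_exists.1 hv
    obtain ⟨z, rfl⟩ := Sym2.mem_iff_exists.1 hv'
    rw [mk_mem_involutionEdges hf.1] at he he'
    exact hne (by rw [← he.2, ← he'.2])

lemma IsMatchingSet.exists_involution {G : SimpleGraph V} {M : Set (Sym2 V)}
    (hM : IsMatchingSet G M) : ∃ f, IsMatchingInvolution G f ∧ involutionEdges f = M := by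
  classical
  have uniq : ∀ {x y z}, s(x, y) ∈ M → s(x, z) ∈ M → y = z := by
    intro x y z hy hz
    by_contra hne
    refine hM.2 _ hy _ hz (fun h => hne ?_) x (Sym2.mem_mk_left _ _) (Sym2.mem_mk_left _ _)
    exact Sym2.congr_right.1 h
  let f : V → V := fun x => if h : ∃ y, s(x, y) ∈ M then h.choose else x
  have hpos : ∀ {x y}, s(x, y) ∈ M → f x = y := by
    intro x y h
    have hex : ∃ y, s(x, y) ∈ M := ⟨y, h⟩
    simp only [f, dif_pos hex]
    exact uniq hex.choose_spec h
  have hmem : ∀ {x}, f x ≠ x → s(x, f x) ∈ M := by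
    intro x hx
    by_cases h : ∃ y, s(x, y) ∈ M
    · obtain ⟨y, hy⟩ := h
      rwa [hpos hy]
    · exact absurd (by simp only [f, dif_neg h]) hx
  have hinv : Function.Involutive f := by
    intro x
    by_cases hx : f x = x
    · rw [hx, hx]
    · exact hpos (Sym2.eq_swap ▸ hmem hx)
  refine ⟨f, ⟨hinv, fun x hx => hM.1 (hmem hx)⟩, ?_⟩
  ext e
  induction e with
  | h x y =>
    rw [mk_mem_involutionEdges hinv]
    constructor
    · rintro ⟨hne, rfl⟩
      exact hmem hne.symm
    · exact fun h => ⟨(hM.1 h : G.Adj x y).ne, hpos h⟩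

lemma two_mul_ncard_involutionEdges_add [Finite V] {f : V → V} (hf : Function.Involutive f) :
    2 * (involutionEdges f).ncard + (Function.fixedPoints f).ncard = Nat.card V := by
  classical
  have := Fintype.ofFinite V
  have hfix : (Function.fixedPoints f).ncard = (Finset.univ.filter fun x => f x = x).card := by
    rw [← Set.ncard_coe_finset]; congr 1; ext; simp [Function.IsFixedPt]
  have hedge : involutionEdges f =
      (((Finset.univ.filter fun x => f x ≠ x).image fun x => s(x, f x) : Finset (Sym2 V)) :
        Set (Sym2 V)) := by
    ext e; simp [involutionEdges, eq_comm]
  have hcard := Finset.card_eq_sum_card_image (fun x => s(x, f x))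
    (Finset.univ.filter fun x => f x ≠ x)
  rw [Finset.sum_const_nat (m := 2)] at hcard
  · have hsplit := Finset.card_filter_add_card_filter_not (s := (Finset.univ : Finset V))
      (fun x => f x = x)
    rw [hfix, hedge, Set.ncard_coe_finset, Nat.card_eq_fintype_card, ← Finset.card_univ]
    simp only [ne_eq] at hcard hsplit ⊢
    lia
  · intro e he
    obtain ⟨x, hx, rfl⟩ := Finset.mem_image.1 he
    have hx' : f x ≠ x := (Finset.mem_filter.1 hx).2
    rw [Finset.card_eq_two]
    refine ⟨x, f x, hx'.symm, ?_⟩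
    ext y
    simp only [Finset.mem_filter, Finset.mem_univ, true_and, Sym2.eq_iff, Finset.mem_insert,
      Finset.mem_singleton]
    constructor
    · rintro ⟨-, ⟨h, -⟩ | ⟨h, -⟩⟩ <;> simp [h]
    · rintro (rfl | rfl)
      · exact ⟨hx', Or.inl ⟨rfl, rfl⟩⟩
      · exact ⟨by rw [hf x]; exact hx'.symm, Or.inr ⟨rfl, hf x⟩⟩

lemma isMaximumMatching_involutionEdges_iff [Finite V] {G : SimpleGraph V} {f : V → V}
    (hf : IsMatchingInvolution G f) :
    IsMaximumMatching G (involutionEdges f) ↔ IsOptimalInvolution G f := by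
  have hcf := two_mul_ncard_involutionEdges_add hf.1
  constructor
  · refine fun h => ⟨hf, fun g hg => ?_⟩
    have := h.2 _ hg.isMatchingSet
    have := two_mul_ncard_involutionEdges_add hg.1
    lia
  · refine fun h => ⟨hf.isMatchingSet, fun M hM => ?_⟩
    obtain ⟨g, hg, rfl⟩ := hM.exists_involution
    have := h.2 g hg
    have := two_mul_ncard_involutionEdges_add hg.1
    lia

lemma mem_Dset_iff [Finite V] {G : SimpleGraph V} {v : V} :
    v ∈ Dset G ↔ ∃ f, IsOptimalInvolution G f ∧ f v = v := by
  constructor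
  · rintro ⟨M, hM, hv⟩
    obtain ⟨f, hf, rfl⟩ := hM.1.exists_involution
    rw [mem_matVerts_involutionEdges hf.1, not_not] at hv
    exact ⟨f, (isMaximumMatching_involutionEdges_iff hf).1 hM, hv⟩
  · rintro ⟨f, hf, hv⟩
    refine ⟨_, (isMaximumMatching_involutionEdges_iff hf.1).2 hf, ?_⟩
    rwa [mem_matVerts_involutionEdges hf.1.1, not_not]

lemma exists_isOptimalInvolution (G : SimpleGraph V) : ∃ f, IsOptimalInvolution G f := by
  have hne : {f : V → V | IsMatchingInvolution G f}.Nonempty :=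
    ⟨id, fun _ => rfl, fun x hx => absurd rfl hx⟩
  exact ⟨_, Function.argminOn_mem (fun f : V → V => (Function.fixedPoints f).ncard) _ hne,
    fun g hg => Function.argminOn_le (fun f : V → V => (Function.fixedPoints f).ncard) _ hg⟩

open Classical in
/-- Removes the edge at `a` from the matching presented by `f`. -/
noncomputable def unmatch (f : V → V) (a : V) : V → V := fun x => if x = a ∨ x = f a then x else f x

lemma unmatch_self (f : V → V) (a : V) : unmatch f a a = a := by simp [unmatch]

lemma unmatch_partner (f : V → V) (a : V) : unmatch f a (f a) = f a := by simp [unmatch]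

lemma unmatch_of_ne {f : V → V} {a x : V} (h : x ≠ a) (h' : x ≠ f a) : unmatch f a x = f x := by
  simp [unmatch, h, h']

lemma fixedPoints_unmatch (f : V → V) (a : V) :
    Function.fixedPoints (unmatch f a) = insert a (insert (f a) (Function.fixedPoints f)) := by
  ext x
  by_cases h : x = a
  · simp [h, Function.IsFixedPt, unmatch_self]
  by_cases h' : x = f a
  · simp [h', Function.IsFixedPt, unmatch_partner]
  simp [Function.IsFixedPt, unmatch_of_ne h h', h, h']

lemma involutive_unmatch {f : V → V} (hf : Function.Involutive f) (a : V) :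
    Function.Involutive (unmatch f a) := by
  intro x
  by_cases h1 : x = a
  · rw [h1, unmatch_self, unmatch_self]
  by_cases h2 : x = f a
  · rw [h2, unmatch_partner, unmatch_partner]
  rw [unmatch_of_ne h1 h2, unmatch_of_ne, hf x]
  · exact fun h => h2 (by rw [← h, hf x])
  · exact fun h => h1 (hf.injective h)

/-- Two involutions on a finite type, the second fixing `v`: the orbit of `v` under both
contains exactly one further fixed point, counted with multiplicity. -/
lemma exists_alternating_component [Finite V] {f g : V → V} (hf : Function.Involutive f)
    (hg : Function.Involutive g) {v : V} (hv : g v = v) :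
    ∃ X : Set V, v ∈ X ∧ (∀ x ∈ X, f x ∈ X) ∧ (∀ x ∈ X, g x ∈ X) ∧ ∃ w ∈ X,
      (f w = w ∧ (∀ x ∈ X, f x = x → x = w) ∧ ∀ x ∈ X, g x = x → x = v) ∨
      (w ≠ v ∧ g w = w ∧ (∀ x ∈ X, f x ≠ x) ∧ ∀ x ∈ X, g x = x → x = v ∨ x = w) := by
  classical
  induction hn : {x | f x ≠ x}.ncard + {x | g x ≠ x}.ncard using Nat.strong_induction_on
    generalizing f g v with
  | _ n ih =>
  by_cases hfv : f v = v
  · refine ⟨{v}, rfl, ?_, ?_, v, rfl, Or.inl ⟨hfv, ?_, ?_⟩⟩ <;> simp +contextual [hfv, hv]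
  have hf' := involutive_unmatch hf v
  have hfix : ∀ x, f x = x → unmatch f v x = x := fun x hx => by
    simp only [unmatch]; split_ifs <;> simp [hx]
  have hlt : {x | unmatch f v x ≠ x}.ncard < {x | f x ≠ x}.ncard := by
    refine Set.ncard_lt_ncard ⟨fun x hx h => hx (hfix x h), fun h => ?_⟩
    exact h (show v ∈ {x | f x ≠ x} from hfv) (unmatch_self f v)
  obtain ⟨X, hvX, hgX, hfX, w, hwX, hw⟩ := ih _ (by rw [← hn, add_comm]; lia) hg hf'
    (unmatch_partner f v) rfl
  have hffv : f (f v) = v := hf v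
  have hvX' : v ∉ X := by
    intro h
    rcases hw with ⟨-, -, h2⟩ | ⟨-, -, h2, -⟩
    · exact hfv (h2 v h (unmatch_self f v)).symm
    · exact h2 v h hv
  refine ⟨insert v X, Set.mem_insert _ _, ?_, ?_, w, Set.mem_insert_of_mem _ hwX, ?_⟩
  · rintro x (rfl | hx)
    · exact Set.mem_insert_of_mem _ hvX
    · by_cases h2 : x = f v
      · rw [h2, hffv]; exact Set.mem_insert _ _
      · have h1 : x ≠ v := fun h => hvX' (h ▸ hx)
        rw [← unmatch_of_ne h1 h2]
        exact Set.mem_insert_of_mem _ (hfX x hx)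
  · rintro x (rfl | hx)
    · rw [hv]; exact Set.mem_insert _ _
    · exact Set.mem_insert_of_mem _ (hgX x hx)
  · rcases hw with ⟨h1, h2, h3⟩ | ⟨h1, h2, h3, h4⟩
    · right
      refine ⟨fun h => hvX' (h ▸ hwX), h1, ?_, ?_⟩
      · rintro x (rfl | hx) h
        · exact hfv h
        · rw [h3 x hx (hfix x h), hffv] at h
          exact hfv h.symm
      · rintro x (rfl | hx) h
        · exact Or.inl rfl
        · exact Or.inr (h2 x hx h)
    · left
      refine ⟨?_, ?_, ?_⟩
      · rwa [unmatch_of_ne (fun h : w = v => hvX' (h ▸ hwX)) h1] at h2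
      · rintro x (rfl | hx) h
        · exact absurd h hfv
        · rcases h4 x hx (hfix x h) with rfl | rfl
          · rw [hffv] at h
            exact absurd h.symm hfv
          · rfl
      · rintro x (rfl | hx) h
        · rfl
        · exact absurd h (h3 x hx)

lemma IsMatchingInvolution.unmatch {G : SimpleGraph V} {f : V → V}
    (hf : IsMatchingInvolution G f) (a : V) : IsMatchingInvolution G (unmatch f a) := by
  refine ⟨involutive_unmatch hf.1 a, fun x hx => ?_⟩
  have h1 : x ≠ a := fun h => hx (h ▸ unmatch_self f a)
  have h2 : x ≠ f a := fun h => hx (h ▸ unmatch_partner f a)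
  rw [unmatch_of_ne h1 h2] at hx ⊢
  exact hf.2 x hx

lemma ncard_fixedPoints_unmatch [Finite V] {f : V → V} (hf : Function.Involutive f) {a : V}
    (ha : f a ≠ a) :
    (Function.fixedPoints (unmatch f a)).ncard = (Function.fixedPoints f).ncard + 2 := by
  rw [fixedPoints_unmatch, Set.ncard_insert_of_notMem, Set.ncard_insert_of_notMem]
  · simpa [Function.IsFixedPt, hf a] using ha.symm
  · simp [Function.IsFixedPt, ha, ha.symm]

open Classical in
lemma IsMatchingInvolution.exists_add_edge [Finite V] {G : SimpleGraph V} {f : V → V}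
    (hf : IsMatchingInvolution G f) {a u : V} (ha : f a = a) (hu : f u = u) (hau : G.Adj a u) :
    ∃ g, IsMatchingInvolution G g ∧ (∀ x, x ≠ a → x ≠ u → g x = f x) ∧
      (Function.fixedPoints g).ncard + 2 = (Function.fixedPoints f).ncard := by
  let g : V → V := fun x => if x = a then u else if x = u then a else f x
  have hga : g a = u := by simp [g]
  have hgu : g u = a := by simp [g, hau.ne']
  have hg : ∀ x, x ≠ a → x ≠ u → g x = f x := fun x h1 h2 => by simp [g, h1, h2]
  have hinv : Function.Involutive g := by
    intro x
    by_cases h1 : x = a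
    · rw [h1, hga, hgu]
    by_cases h2 : x = u
    · rw [h2, hgu, hga]
    rw [hg x h1 h2, hg, hf.1 x]
    · exact fun h => h1 (by rw [← hf.1 x, h, ha])
    · exact fun h => h2 (by rw [← hf.1 x, h, hu])
  refine ⟨g, ⟨hinv, fun x hx => ?_⟩, hg, ?_⟩
  · by_cases h1 : x = a
    · rw [h1, hga]; exact hau
    by_cases h2 : x = u
    · rw [h2, hgu]; exact hau.symm
    rw [hg x h1 h2] at hx ⊢
    exact hf.2 x hx
  · rw [← ncard_fixedPoints_unmatch hinv (a := a) (by rw [hga]; exact hau.ne')]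
    congr 1
    rw [fixedPoints_unmatch, hga]
    ext x
    by_cases h1 : x = a
    · simp [h1, Function.IsFixedPt, ha]
    by_cases h2 : x = u
    · simp [h2, Function.IsFixedPt, hu]
    simp [h1, h2, Function.IsFixedPt, hg x h1 h2]

lemma IsMatchingInvolution.piecewise {G : SimpleGraph V} {f g : V → V}
    (hf : IsMatchingInvolution G f) (hg : IsMatchingInvolution G g) {X : Set V}
    [∀ x, Decidable (x ∈ X)]
    (hfX : ∀ x ∈ X, f x ∈ X) (hgX : ∀ x ∈ X, g x ∈ X) :
    IsMatchingInvolution G (X.piecewise g f) := by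
  have hfX' : ∀ x ∉ X, f x ∉ X := fun x hx h => hx (hf.1 x ▸ hfX _ h)
  refine ⟨fun x => ?_, fun x hx => ?_⟩
  · by_cases h : x ∈ X
    · simp [h, hgX x h, hg.1 x]
    · simp [h, hfX' x h, hf.1 x]
  · by_cases h : x ∈ X
    · simp only [Set.piecewise_eq_of_mem _ _ _ h] at hx ⊢
      exact hg.2 x hx
    · simp only [Set.piecewise_eq_of_notMem _ _ _ h] at hx ⊢
      exact hf.2 x hx

/-- The graph obtained from `G` by deleting all edges meeting `S`. -/
def isolate (G : SimpleGraph V) (S : Set V) : SimpleGraph V where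
  Adj x y := G.Adj x y ∧ x ∉ S ∧ y ∉ S
  symm := ⟨fun _ _ h => ⟨h.1.symm, h.2.2, h.2.1⟩⟩
  loopless := ⟨fun _ h => h.1.ne rfl⟩

lemma isMatchingInvolution_isolate_iff {G : SimpleGraph V} {S : Set V} {f : V → V} :
    IsMatchingInvolution (isolate G S) f ↔ IsMatchingInvolution G f ∧ ∀ x ∈ S, f x = x := by
  constructor
  · refine fun h => ⟨⟨h.1, fun x hx => (h.2 x hx).1⟩, fun x hx => ?_⟩
    by_contra hne
    exact (h.2 x hne).2.1 hx
  · rintro ⟨h, hS⟩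
    refine ⟨h.1, fun x hx => ⟨h.2 x hx, fun hxS => hx (hS x hxS), fun hxS => hx ?_⟩⟩
    rw [← hS _ hxS, h.1 x]

lemma isolate_empty (G : SimpleGraph V) : isolate G ∅ = G := by
  ext; simp [isolate]

lemma isolate_isolate_singleton (G : SimpleGraph V) (S : Set V) (a : V) :
    isolate (isolate G S) {a} = isolate G (insert a S) := by
  ext; simp [isolate]; tauto

lemma IsOptimalInvolution.ncard_eq {G : SimpleGraph V} {f g : V → V}
    (hf : IsOptimalInvolution G f) (hg : IsOptimalInvolution G g) :
    (Function.fixedPoints f).ncard = (Function.fixedPoints g).ncard :=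
  le_antisymm (hf.2 g hg.1) (hg.2 f hf.1)

lemma IsOptimalInvolution.of_ncard_le {G : SimpleGraph V} {f g : V → V}
    (hf : IsOptimalInvolution G f) (hg : IsMatchingInvolution G g)
    (h : (Function.fixedPoints g).ncard ≤ (Function.fixedPoints f).ncard) :
    IsOptimalInvolution G g :=
  ⟨hg, fun k hk => h.trans (hf.2 k hk)⟩

lemma ncard_fixedPoints_isolate_singleton [Finite V] {G : SimpleGraph V} {a : V}
    (ha : a ∉ Dset G) {f g : V → V} (hf : IsOptimalInvolution G f)
    (hg : IsOptimalInvolution (isolate G {a}) g) :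
    (Function.fixedPoints g).ncard = (Function.fixedPoints f).ncard + 2 := by
  rw [mem_Dset_iff] at ha
  have hfa : f a ≠ a := fun h => ha ⟨f, hf, h⟩
  obtain ⟨hg', hga⟩ := isMatchingInvolution_isolate_iff.1 hg.1
  have hle := hg.2 (unmatch f a) (isMatchingInvolution_isolate_iff.2
    ⟨hf.1.unmatch a, fun x hx => by rw [Set.mem_singleton_iff.1 hx, unmatch_self]⟩)
  rw [ncard_fixedPoints_unmatch hf.1.1 hfa] at hle
  have hlt : (Function.fixedPoints f).ncard < (Function.fixedPoints g).ncard := by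
    by_contra! h
    exact ha ⟨g, hf.of_ncard_le hg' h, hga a rfl⟩
  have := two_mul_ncard_involutionEdges_add hf.1.1
  have := two_mul_ncard_involutionEdges_add hg'.1
  lia

/-- The stability lemma of Gallai–Edmonds theory. -/
lemma Dset_isolate_singleton [Finite V] {G : SimpleGraph V} {a u : V} (ha : a ∉ Dset G)
    (hu : u ∈ Dset G) (hau : G.Adj a u) : Dset (isolate G {a}) = insert a (Dset G) := by
  classical
  refine Set.Subset.antisymm (fun v hv => ?_) (Set.insert_subset ?_ fun v hv => ?_)
  · obtain ⟨g, hg, hgv⟩ := mem_Dset_iff.1 hv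
    obtain ⟨f, hf, hfu⟩ := mem_Dset_iff.1 hu
    have hcard := ncard_fixedPoints_isolate_singleton ha hf hg
    obtain ⟨hg', hga⟩ := isMatchingInvolution_isolate_iff.1 hg.1
    replace hga : g a = a := hga a rfl
    by_cases hva : v = a
    · exact Or.inl hva
    refine Or.inr ?_
    obtain ⟨X, hvX, hfX, hgX, w, hwX, ⟨hw, hfw, hgw⟩ | ⟨hwv, hw, hfw, hgw⟩⟩ :=
      exists_alternating_component hf.1.1 hg'.1 hgv
    · refine mem_Dset_iff.2 ⟨X.piecewise g f,
        hf.of_ncard_le (hf.1.piecewise hg' hfX hgX) ?_, by simp [hvX, hgv]⟩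
      have hsub : Function.fixedPoints (X.piecewise g f) ⊆
          insert v (Function.fixedPoints f \ {w}) := by
        intro x hx
        by_cases hxX : x ∈ X
        · simp only [Function.mem_fixedPoints, Function.IsFixedPt, hxX,
            Set.piecewise_eq_of_mem] at hx
          exact Or.inl (hgw x hxX hx)
        · simp only [Function.mem_fixedPoints, Function.IsFixedPt, hxX, not_false_eq_true,
            Set.piecewise_eq_of_notMem] at hx
          exact Or.inr ⟨hx, fun h => hxX (Set.mem_singleton_iff.1 h ▸ hwX)⟩
      have h1 := Set.ncard_le_ncard hsub
      have h2 := Set.ncard_insert_le v (Function.fixedPoints f \ {w})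
      have h3 := Set.ncard_sdiff_singleton_add_one (show w ∈ Function.fixedPoints f from hw)
      lia
    · by_cases haX : a ∈ X
      · obtain rfl : a = w := (hgw a haX hga).resolve_left (Ne.symm hva)
        have huX : u ∉ X := fun h => hfw u h hfu
        obtain ⟨k, hk, hkv, hkcard⟩ := (hf.1.piecewise hg' hfX hgX).exists_add_edge
          (a := a) (u := u) (by simp [haX, hga]) (by simp [huX, hfu]) hau
        refine mem_Dset_iff.2 ⟨k, hf.of_ncard_le hk ?_, ?_⟩
        · have hsub : Function.fixedPoints (X.piecewise g f) ⊆
              insert v (insert a (Function.fixedPoints f)) := by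
            intro x hx
            by_cases hxX : x ∈ X
            · simp only [Function.mem_fixedPoints, Function.IsFixedPt, hxX,
                Set.piecewise_eq_of_mem] at hx
              exact (hgw x hxX hx).imp_right Or.inl
            · simp only [Function.mem_fixedPoints, Function.IsFixedPt, hxX, not_false_eq_true,
                Set.piecewise_eq_of_notMem] at hx
              exact Or.inr (Or.inr hx)
          have h1 := Set.ncard_le_ncard hsub
          have h2 := Set.ncard_insert_le v (insert a (Function.fixedPoints f))
          have h3 := Set.ncard_insert_le a (Function.fixedPoints f)
          lia
        · rw [hkv v hva fun h => huX (h ▸ hvX)]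
          simp [hvX, hgv]
      · exfalso
        have hk := hg.2 (X.piecewise f g) (isMatchingInvolution_isolate_iff.2
          ⟨hg'.piecewise hf.1 hgX hfX, fun x hx => by
            rw [Set.mem_singleton_iff.1 hx]; simp [haX, hga]⟩)
        have hlt : (Function.fixedPoints (X.piecewise f g)).ncard <
            (Function.fixedPoints g).ncard := by
          refine Set.ncard_lt_ncard ⟨fun x hx => ?_, fun h => ?_⟩
          · by_cases hxX : x ∈ X
            · simp only [Function.mem_fixedPoints, Function.IsFixedPt, hxX,
                Set.piecewise_eq_of_mem] at hx
              exact absurd hx (hfw x hxX)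
            · simpa [Function.IsFixedPt, hxX] using hx
          · have := h (show v ∈ Function.fixedPoints g from hgv)
            simp only [Function.mem_fixedPoints, Function.IsFixedPt, hvX,
                Set.piecewise_eq_of_mem] at this
            exact hfw v hvX this
        lia
  · obtain ⟨g, hg⟩ := exists_isOptimalInvolution (isolate G {a})
    exact mem_Dset_iff.2 ⟨g, hg, (isMatchingInvolution_isolate_iff.1 hg.1).2 a rfl⟩
  · obtain ⟨g, hg⟩ := exists_isOptimalInvolution (isolate G {a})
    obtain ⟨f, hf, hfv⟩ := mem_Dset_iff.1 hv
    have hfa : f a ≠ a := fun h => ha (mem_Dset_iff.2 ⟨f, hf, h⟩)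
    refine mem_Dset_iff.2 ⟨unmatch f a, hg.of_ncard_le (isMatchingInvolution_isolate_iff.2
      ⟨hf.1.unmatch a, fun x hx => by rw [Set.mem_singleton_iff.1 hx, unmatch_self]⟩) ?_, ?_⟩
    · rw [ncard_fixedPoints_unmatch hf.1.1 hfa, ncard_fixedPoints_isolate_singleton ha hf hg]
    · have : v ∈ Function.fixedPoints (unmatch f a) := by
        rw [fixedPoints_unmatch]
        exact Or.inr (Or.inr hfv)
      exact this

lemma Dset_isolate_of_subset_Aset [Finite V] {G : SimpleGraph V} {S : Set V} (hS : S ⊆ Aset G) :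
    Dset (isolate G S) = S ∪ Dset G ∧ ∀ f g, IsOptimalInvolution G f →
      IsOptimalInvolution (isolate G S) g →
      (Function.fixedPoints g).ncard = (Function.fixedPoints f).ncard + 2 * S.ncard := by
  induction S, S.toFinite using Set.Finite.induction_on with
  | empty => simpa [isolate_empty] using fun f g hf hg => hg.ncard_eq hf
  | @insert a S haS _ ih =>
    obtain ⟨hD, hcard⟩ := ih ((Set.subset_insert _ _).trans hS)
    obtain ⟨haD, u, hu, hau⟩ := hS (Set.mem_insert a S)
    have haD' : a ∉ Dset (isolate G S) := by
      rw [hD]; exact fun h => h.elim haS haD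
    have huS : u ∉ S := fun h => (hS (Set.mem_insert_of_mem a h)).1 hu
    have hu' : u ∈ Dset (isolate G S) := by rw [hD]; exact Or.inr hu
    rw [← isolate_isolate_singleton]
    refine ⟨?_, fun f g hf hg => ?_⟩
    · rw [Dset_isolate_singleton haD' hu' ⟨hau, haS, huS⟩, hD, Set.insert_union]
    · obtain ⟨k, hk⟩ := exists_isOptimalInvolution (isolate G S)
      rw [ncard_fixedPoints_isolate_singleton haD' hk hg, hcard f k hf hk,
        Set.ncard_insert_of_notMem haS]
      ring

/-- Removing `A(G)` lowers the matching number by `|A(G)|`. -/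
lemma IsOptimalInvolution.ncard_add_le_of_fixes_Aset [Finite V] {G : SimpleGraph V} {f p : V → V}
    (hf : IsOptimalInvolution G f) (hp : IsMatchingInvolution G p)
    (hpA : ∀ x ∈ Aset G, p x = x) :
    (Function.fixedPoints f).ncard + 2 * (Aset G).ncard ≤ (Function.fixedPoints p).ncard := by
  obtain ⟨g, hg⟩ := exists_isOptimalInvolution (isolate G (Aset G))
  rw [← (Dset_isolate_of_subset_Aset subset_rfl).2 f g hf hg]
  exact hg.2 p (isMatchingInvolution_isolate_iff.2 ⟨hp, hpA⟩)

lemma isMatchingSet_range_mk {α W : Type*} {K : SimpleGraph W} {φ ψ : α → W}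
    (hφ : Function.Injective φ) (hψ : Function.Injective ψ) (hne : ∀ a b, φ a ≠ ψ b)
    (hadj : ∀ a, K.Adj (φ a) (ψ a)) :
    IsMatchingSet K (Set.range fun a => s(φ a, ψ a)) := by
  refine ⟨?_, ?_⟩
  · rintro _ ⟨a, rfl⟩
    exact hadj a
  · rintro _ ⟨a, rfl⟩ _ ⟨b, rfl⟩ hab v hv hv'
    refine hab ?_
    rcases Sym2.mem_iff.1 hv with rfl | rfl <;> rcases Sym2.mem_iff.1 hv' with h | h
    · rw [hφ h]
    · exact absurd h (hne _ _)
    · exact absurd h.symm (hne _ _)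
    · rw [hψ h]

lemma matVerts_range_mk {α W : Type*} (φ ψ : α → W) :
    matVerts (Set.range fun a => s(φ a, ψ a)) = Set.range φ ∪ Set.range ψ := by
  ext v
  constructor
  · rintro ⟨_, ⟨a, rfl⟩, hv⟩
    rcases Sym2.mem_iff.1 hv with rfl | rfl
    · exact Or.inl ⟨a, rfl⟩
    · exact Or.inr ⟨a, rfl⟩
  · rintro (⟨a, rfl⟩ | ⟨a, rfl⟩)
    · exact ⟨_, ⟨a, rfl⟩, Sym2.mem_mk_left _ _⟩
    · exact ⟨_, ⟨a, rfl⟩, Sym2.mem_mk_right _ _⟩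

lemma even_ncard_of_involutive [Finite V] {T : Set V} {f : V → V}
    (hf : ∀ x ∈ T, f x ∈ T ∧ f (f x) = x ∧ f x ≠ x) : Even T.ncard := by
  let k : T → T := fun x => ⟨f x, (hf x x.2).1⟩
  have hk : Function.Involutive k := fun x => Subtype.ext (hf x x.2).2.1
  have hfix : Function.fixedPoints k = ∅ := by
    ext x
    simpa [Function.IsFixedPt, k, Subtype.ext_iff] using (hf x x.2).2.2
  have h := two_mul_ncard_involutionEdges_add hk
  rw [hfix, Set.ncard_empty, Nat.card_coe_set_eq] at h
  exact ⟨_, by rw [← h]; ring⟩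

lemma exists_involution_of_existsUnique {G : SimpleGraph V} {T : Set V}
    (h : ∃! N : Set (Sym2 T), IsPerfectMatchingSet (G.induce T) N) :
    ∃ q : V → V, (∀ x ∈ T, q x ∈ T ∧ q (q x) = x ∧ G.Adj x (q x)) ∧
      ∀ f, IsMatchingInvolution G f → (∀ x ∈ T, f x ∈ T ∧ f x ≠ x) → ∀ x ∈ T, f x = q x := by
  classical
  obtain ⟨N, hN, huniq⟩ := h
  obtain ⟨k, hk, rfl⟩ := hN.1.exists_involution
  have hne : ∀ x, k x ≠ x := fun x =>
    (mem_matVerts_involutionEdges hk.1).1 (hN.2 ▸ Set.mem_univ x)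
  let q : V → V := fun x => if hx : x ∈ T then k ⟨x, hx⟩ else x
  have hq : ∀ x : T, q x = k x := fun x => by simp [q]
  refine ⟨q, fun x hx => ?_, fun f hf hfT x hx => ?_⟩
  · lift x to T using hx
    rw [hq, hq, hk.1 x]
    exact ⟨(k x).2, rfl, hk.2 x (hne x)⟩
  · lift x to T using hx
    let j : T → T := fun x => ⟨f x, (hfT x x.2).1⟩
    have hj : IsMatchingInvolution (G.induce T) j :=
      ⟨fun x => Subtype.ext (hf.1 x), fun x _ => hf.2 x (hfT x x.2).2⟩
    have hjk : j = k := by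
      refine eq_of_involutionEdges_eq hj.1 hk.1 (huniq _ ⟨hj.isMatchingSet, ?_⟩)
      refine Set.eq_univ_of_forall fun x => (mem_matVerts_involutionEdges hj.1).2 fun h => ?_
      exact (hfT x x.2).2 (congrArg Subtype.val h)
    rw [hq, ← hjk]

/-- Unique perfect matchings on pairwise disjoint vertex sets glue. -/
lemma exists_involution_of_existsUnique_family {ι : Type*} {G : SimpleGraph V} {T : ι → Set V}
    (hdisj : ∀ i j x, x ∈ T i → x ∈ T j → i = j)
    (h : ∀ i, ∃! N : Set (Sym2 (T i)), IsPerfectMatchingSet (G.induce (T i)) N) :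
    ∃ p : V → V, IsMatchingInvolution G p ∧ (∀ x, p x ≠ x ↔ ∃ i, x ∈ T i) ∧
      ∀ f, IsMatchingInvolution G f → (∀ i, ∀ x ∈ T i, f x ∈ T i ∧ f x ≠ x) →
        ∀ i, ∀ x ∈ T i, f x = p x := by
  classical
  choose q hq huniq using fun i => exists_involution_of_existsUnique (h i)
  let p : V → V := fun x => if hx : ∃ i, x ∈ T i then q hx.choose x else x
  have hp : ∀ i, ∀ x ∈ T i, p x = q i x := by
    intro i x hx
    have hex : ∃ i, x ∈ T i := ⟨i, hx⟩
    simp only [p, dif_pos hex]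
    rw [hdisj _ _ x hex.choose_spec hx]
  have hp' : ∀ x, (¬ ∃ i, x ∈ T i) → p x = x := fun x hx => dif_neg hx
  refine ⟨p, ⟨fun x => ?_, fun x hx => ?_⟩, fun x => ⟨fun hx => ?_, ?_⟩, ?_⟩
  · by_cases hx : ∃ i, x ∈ T i
    · obtain ⟨i, hi⟩ := hx
      rw [hp i x hi, hp i _ (hq i x hi).1, (hq i x hi).2.1]
    · rw [hp' x hx, hp' x hx]
  · obtain ⟨i, hi⟩ := not_imp_comm.1 (hp' x) hx
    rw [hp i x hi]
    exact (hq i x hi).2.2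
  · exact not_imp_comm.1 (hp' x) hx
  · rintro ⟨i, hi⟩
    rw [hp i x hi]
    exact (hq i x hi).2.2.ne'
  · intro f hf hfT i x hx
    rw [hp i x hx, huniq i f hf (hfT i) x hx]

section Components

variable {G : SimpleGraph V} {S : Set V} {H H' : (G.induce S).ConnectedComponent} {x y : V}

lemma mem_of_mem_compSet (hx : x ∈ compSet G S H) : x ∈ S := hx.1

lemma exists_mem_compSet (hx : x ∈ S) : ∃ H, x ∈ compSet G S H := ⟨_, hx, rfl⟩

lemma eq_of_mem_compSet (hx : x ∈ compSet G S H) (hx' : x ∈ compSet G S H') : H = H' := by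
  obtain ⟨_, rfl⟩ := hx
  obtain ⟨_, rfl⟩ := hx'
  rfl

lemma mem_compSet_of_adj (hx : x ∈ compSet G S H) (hy : y ∈ S) (h : G.Adj x y) :
    y ∈ compSet G S H := by
  obtain ⟨hxS, rfl⟩ := hx
  exact ⟨hy, SimpleGraph.ConnectedComponent.sound
    (SimpleGraph.Adj.reachable (show (G.induce S).Adj ⟨y, hy⟩ ⟨x, hxS⟩ from h.symm))⟩

end Components

lemma GB_adj_inl_inr {G : SimpleGraph V} {a : Aset G} {H : DComp G} :
    (GB G).Adj (Sum.inl a) (Sum.inr H) ↔ ∃ d ∈ compSet G (Dset G) H, G.Adj a.1 d := by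
  simp only [GB, SimpleGraph.fromRel_adj]
  constructor
  · rintro ⟨-, ⟨a', H', ha, hH, h⟩ | ⟨a', H', ha, -⟩⟩
    · cases ha; cases hH; exact h
    · cases ha
  · exact fun h => ⟨Sum.inl_ne_inr, Or.inl ⟨a, H, rfl, rfl, h⟩⟩

/-- A component of `G[D(G)]` which has a near-perfect matching is odd, so every matching leaves
one of its vertices uncovered or matches it into `A(G)`. -/
lemma IsMatchingInvolution.exists_mem_compSet_fixed_or_mem_Aset [Finite V] {G : SimpleGraph V}
    {f : V → V} (hf : IsMatchingInvolution G f) {H : DComp G} {h : V}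
    (hh : h ∈ compSet G (Dset G) H) (hPM : UniquePMminus G (compSet G (Dset G) H) h) :
    ∃ z ∈ compSet G (Dset G) H, f z = z ∨ f z ∈ Aset G := by
  by_contra! hcon
  have heven : Even (compSet G (Dset G) H).ncard := by
    refine even_ncard_of_involutive fun x hx => ⟨?_, hf.1 x, (hcon x hx).1⟩
    have hadj := hf.2 x (hcon x hx).1
    refine mem_compSet_of_adj hx ?_ hadj
    by_contra hD
    exact (hcon x hx).2 ⟨hD, x, mem_of_mem_compSet hx, hadj.symm⟩
  obtain ⟨q, hq, -⟩ := exists_involution_of_existsUnique hPM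
  have heven' : Even (compSet G (Dset G) H \ {h}).ncard :=
    even_ncard_of_involutive fun x hx => ⟨(hq x hx).1, (hq x hx).2.1, (hq x hx).2.2.ne'⟩
  rw [← Set.ncard_sdiff_singleton_add_one hh] at heven
  exact (Nat.even_add_one.1 heven) heven'

lemma exists_near_perfect_involution {G : SimpleGraph V}
    (h1 : ∀ H : (G.induce (Cset G)).ConnectedComponent,
      ∃! N : Set (Sym2 ↥(compSet G (Cset G) H)),
        IsPerfectMatchingSet (G.induce (compSet G (Cset G) H)) N)
    {r : DComp G → V} (hr : ∀ H, r H ∈ compSet G (Dset G) H)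
    (hrPM : ∀ H, UniquePMminus G (compSet G (Dset G) H) (r H)) :
    ∃ p : V → V, IsMatchingInvolution G p ∧ (∀ x, p x = x ↔ x ∈ Aset G ∪ Set.range r) ∧
      ∀ f, IsMatchingInvolution G f → (∀ x ∈ Cset G, f x ∈ Cset G ∧ f x ≠ x) →
        (∀ H, ∀ x ∈ compSet G (Dset G) H \ {r H},
          f x ∈ compSet G (Dset G) H \ {r H} ∧ f x ≠ x) →
        ∀ x ∉ Aset G ∪ Set.range r, f x = p x := by
  let T : (G.induce (Cset G)).ConnectedComponent ⊕ DComp G → Set V :=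
    Sum.elim (fun K => compSet G (Cset G) K) (fun H => compSet G (Dset G) H \ {r H})
  have hdisj : ∀ i j x, x ∈ T i → x ∈ T j → i = j := by
    rintro (K | H) (K' | H') x hx hx'
    · exact congrArg _ (eq_of_mem_compSet hx hx')
    · exact absurd (mem_of_mem_compSet hx'.1) (mem_of_mem_compSet hx).1
    · exact absurd (mem_of_mem_compSet hx.1) (mem_of_mem_compSet hx').1
    · exact congrArg _ (eq_of_mem_compSet hx.1 hx'.1)
  have hT : ∀ x, (∃ i, x ∈ T i) ↔ x ∉ Aset G ∪ Set.range r := by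
    intro x
    constructor
    · rintro ⟨K | H, hx⟩ (hA | ⟨H', rfl⟩)
      · exact (mem_of_mem_compSet hx).2 hA
      · exact (mem_of_mem_compSet hx).1 (mem_of_mem_compSet (hr H'))
      · exact hA.1 (mem_of_mem_compSet hx.1)
      · exact hx.2 (congrArg r (eq_of_mem_compSet (hr H') hx.1))
    · intro hx
      by_cases hD : x ∈ Dset G
      · obtain ⟨H, hH⟩ := exists_mem_compSet (G := G) hD
        exact ⟨Sum.inr H, hH, fun h => hx (Or.inr ⟨H, h.symm⟩)⟩
      · obtain ⟨K, hK⟩ := exists_mem_compSet (G := G) (S := Cset G)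
          ⟨hD, fun h => hx (Or.inl h)⟩
        exact ⟨Sum.inl K, hK⟩
  obtain ⟨p, hp, hpfix, huniq⟩ := exists_involution_of_existsUnique_family (G := G) hdisj
    (Sum.rec h1 hrPM)
  refine ⟨p, hp, fun x => ?_, fun f hf hC hD x hx => ?_⟩
  · rw [← not_iff_not, ← hT, ← hpfix]
  · obtain ⟨i, hi⟩ := (hT x).2 hx
    refine huniq f hf ?_ i x hi
    rintro (K | H) y hy
    · obtain ⟨hfC, hne⟩ := hC y (mem_of_mem_compSet hy)
      exact ⟨mem_compSet_of_adj hy hfC (hf.2 y hne), hne⟩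
    · exact hD H y hy

lemma injective_of_mem_compSet {G : SimpleGraph V} {S : Set V}
    {z : (G.induce S).ConnectedComponent → V} (hz : ∀ H, z H ∈ compSet G S H) :
    Function.Injective z :=
  fun H H' h => eq_of_mem_compSet (hz H) (h ▸ hz H')

lemma card_DComp_le [Finite V] {G : SimpleGraph V} {f : V → V} (hf : Function.Involutive f)
    {z : DComp G → V} (hz : ∀ H, z H ∈ compSet G (Dset G) H)
    (hfz : ∀ H, f (z H) = z H ∨ f (z H) ∈ Aset G) :
    Nat.card (DComp G) ≤ (Function.fixedPoints f).ncard + (Aset G).ncard := by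
  rw [← Set.ncard_univ, ← Set.ncard_image_of_injective _
    (hf.injective.comp (injective_of_mem_compSet hz))]
  refine (Set.ncard_le_ncard ?_).trans (Set.ncard_union_le _ _)
  rintro _ ⟨H, -, rfl⟩
  refine (hfz H).imp (fun h => ?_) id
  simp [Function.IsFixedPt, h]

/-- The components of `G[D(G)]` matched into `A(G)` yield a matching of `G_B`. -/
lemma exists_isMatchingSet_GB [Finite V] {G : SimpleGraph V} {f : V → V}
    (hf : IsMatchingInvolution G f) {z : DComp G → V}
    (hz : ∀ H, z H ∈ compSet G (Dset G) H) (hfz : ∀ H, f (z H) = z H ∨ f (z H) ∈ Aset G) :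
    ∃ N, IsMatchingSet (GB G) N ∧
      Nat.card (DComp G) ≤ (Function.fixedPoints f).ncard + N.ncard := by
  have hzinj := injective_of_mem_compSet hz
  let U : Set (DComp G) := {H | f (z H) ∈ Aset G}
  let φ : U → Aset G ⊕ DComp G := fun H => Sum.inl ⟨f (z H), H.2⟩
  let ψ : U → Aset G ⊕ DComp G := fun H => Sum.inr H
  refine ⟨Set.range fun H => s(φ H, ψ H), isMatchingSet_range_mk (fun H H' h => ?_)
    (fun H H' h => Subtype.ext (Sum.inr_injective h)) (fun _ _ => Sum.inl_ne_inr)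
    fun H => GB_adj_inl_inr.2 ⟨z H, hz H, ?_⟩, ?_⟩
  · exact Subtype.ext (hzinj (hf.1.injective (congrArg Subtype.val (Sum.inl_injective h))))
  · have hne : f (z H) ≠ z H := fun h => H.2.1 (h.symm ▸ mem_of_mem_compSet (hz H))
    exact (hf.2 _ hne).symm
  · have hinj : Function.Injective fun H => s(φ H, ψ H) := by
      intro H H' h
      rcases Sym2.eq_iff.1 h with ⟨-, h⟩ | ⟨h, -⟩
      · exact Subtype.ext (Sum.inr_injective h)
      · exact absurd h Sum.inl_ne_inr
    rw [← Set.image_univ, Set.ncard_image_of_injective _ hinj, Set.ncard_univ,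
      Nat.card_coe_set_eq, ← Set.ncard_compl_add_ncard U]
    refine Nat.add_le_add_right ?_ _
    rw [← Set.ncard_image_of_injective Uᶜ hzinj]
    refine Set.ncard_le_ncard ?_
    rintro _ ⟨H, hH, rfl⟩
    exact (hfz H).resolve_right hH

/-- A matching of `G_B` with at least `|A(G)|` edges covers `A(G)`. -/
lemma IsMatchingSet.exists_partner_of_ncard_le [Finite V] {G : SimpleGraph V}
    {MB : Set (Sym2 (Aset G ⊕ DComp G))} (hMB : IsMatchingSet (GB G) MB)
    (hform : ∀ e ∈ MB, ∃ a H, e = s(Sum.inl a, Sum.inr H))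
    (hcard : (Aset G).ncard ≤ MB.ncard) (a : Aset G) : ∃ H, s(Sum.inl a, Sum.inr H) ∈ MB := by
  obtain ⟨k, hk, rfl⟩ := hMB.exists_involution
  by_contra hcon
  let A₀ : Set (Aset G) := {b | ∃ H, s(Sum.inl b, Sum.inr H) ∈ involutionEdges k}
  have hsub : involutionEdges k ⊆ (fun b => s(Sum.inl b, k (Sum.inl b))) '' A₀ := by
    intro e he
    obtain ⟨b, H, rfl⟩ := hform e he
    exact ⟨b, ⟨H, he⟩, by simp only [((mk_mem_involutionEdges hk.1).1 he).2]⟩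
  have hle := (Set.ncard_le_ncard hsub).trans (Set.ncard_image_le)
  have hlt : A₀.ncard < (Set.univ : Set (Aset G)).ncard :=
    Set.ncard_lt_ncard ⟨Set.subset_univ _, fun h => hcon (h (Set.mem_univ a))⟩
  rw [Set.ncard_univ, Nat.card_coe_set_eq] at hlt
  lia

/-- A matching of `G_B` covering `A(G)`, given by the partner map `μ`, combined with
near-perfect matchings of the components of `G[D(G)]` and a perfect matching of `G[C(G)]`. -/
lemma exists_combined_involution {G : SimpleGraph V} {r : DComp G → V}
    (hr : ∀ H, r H ∈ compSet G (Dset G) H) {p : V → V} (hp : IsMatchingInvolution G p)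
    (hpfix : ∀ x, p x = x ↔ x ∈ Aset G ∪ Set.range r) {μ : Aset G → DComp G}
    (hμ : Function.Injective μ) (hadj : ∀ a : Aset G, G.Adj a (r (μ a))) :
    ∃ F, IsMatchingInvolution G F ∧ (∀ a : Aset G, F a = r (μ a)) ∧
      (∀ x ∉ Aset G ∪ Set.range r, F x = p x) ∧
      ∀ x, F x = x ↔ ∃ H ∉ Set.range μ, x = r H := by
  classical
  have hrinj := injective_of_mem_compSet hr
  have hrA : ∀ H, r H ∉ Aset G := fun H h => h.1 (mem_of_mem_compSet (hr H))
  obtain ⟨σ, hσ, hσE⟩ := (isMatchingSet_range_mk (φ := fun a : Aset G => a.1)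
    (ψ := fun a => r (μ a)) Subtype.val_injective (hrinj.comp hμ)
    (fun a b h => hrA _ (h ▸ a.2)) hadj).exists_involution
  have hσfix : ∀ x, σ x ≠ x ↔ x ∈ Aset G ∨ ∃ a, r (μ a) = x := by
    intro x
    rw [← mem_matVerts_involutionEdges hσ.1, hσE, matVerts_range_mk]
    simp
  have hσa : ∀ a : Aset G, σ a = r (μ a) := fun a =>
    ((mk_mem_involutionEdges hσ.1).1 (hσE ▸ ⟨a, rfl⟩)).2
  have hdisj : ∀ x, p x ≠ x → σ x = x := by
    intro x hx
    by_contra h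
    rcases (hσfix x).1 h with h | ⟨a, rfl⟩
    · exact hx ((hpfix x).2 (Or.inl h))
    · exact hx ((hpfix _).2 (Or.inr ⟨_, rfl⟩))
  have hF := hσ.piecewise hp (X := {x | p x ≠ x}) (fun x hx => by rwa [hdisj x hx])
    fun x hx h => hx (hp.1.injective h)
  have hFpos : ∀ x, p x ≠ x → Set.piecewise {x | p x ≠ x} p σ x = p x := fun x hx =>
    Set.piecewise_eq_of_mem _ _ _ hx
  have hFneg : ∀ x, p x = x → Set.piecewise {x | p x ≠ x} p σ x = σ x := fun x hx =>
    Set.piecewise_eq_of_notMem _ _ _ (not_not.2 hx)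
  refine ⟨_, hF, fun a => ?_, fun x hx => hFpos x (mt (hpfix x).1 hx), fun x => ?_⟩
  · rw [hFneg _ ((hpfix _).2 (Or.inl a.2)), hσa]
  · by_cases hx : p x = x
    · rw [hFneg x hx, ← not_iff_not, ← ne_eq, hσfix]
      constructor
      · rintro (h | ⟨a, rfl⟩) ⟨H, hH, hxH⟩
        · exact hrA H (hxH ▸ h)
        · exact hH ⟨a, hrinj hxH⟩
      · intro h
        rcases (hpfix x).1 hx with hA | ⟨H, rfl⟩
        · exact Or.inl hA
        · by_contra! hcon
          exact h ⟨H, fun ⟨a, ha⟩ => hcon.2 a (congrArg r ha), rfl⟩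
    · rw [hFpos x hx]
      refine ⟨fun h => absurd h hx, ?_⟩
      rintro ⟨H, -, rfl⟩
      exact (hpfix _).2 (Or.inr ⟨H, rfl⟩)

/-- A matching leaving uncovered only points `r H`, for the components `H` outside the range of
`μ`, matches `A(G)` into one vertex of each component in the range of `μ`. -/
lemma exists_partner_of_fixed_iff [Finite V] {G : SimpleGraph V} {r z : DComp G → V}
    (hr : ∀ H, r H ∈ compSet G (Dset G) H) {μ : Aset G → DComp G}
    (hμ : Function.Injective μ) {f : V → V} (hf : IsMatchingInvolution G f)
    (hffix : ∀ x, f x = x ↔ ∃ H ∉ Set.range μ, x = r H)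
    (hz : ∀ H, z H ∈ compSet G (Dset G) H) (hfz : ∀ H, f (z H) = z H ∨ f (z H) ∈ Aset G) :
    ∃ β : Aset G → Aset G, Function.Bijective β ∧ ∀ a : Aset G, f a = z (μ (β a)) := by
  have hzA : ∀ a, f (z (μ a)) ∈ Aset G := by
    refine fun a => (hfz _).resolve_left fun h => ?_
    obtain ⟨H, hH, hzH⟩ := (hffix _).1 h
    exact hH ⟨a, eq_of_mem_compSet (hz _) (hzH ▸ hr H)⟩
  let γ : Aset G → Aset G := fun a => ⟨f (z (μ a)), hzA a⟩
  have hγ : Function.Injective γ := fun a b h =>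
    hμ (injective_of_mem_compSet hz (hf.1.injective (congrArg Subtype.val h)))
  let e := Equiv.ofBijective γ (Finite.injective_iff_bijective.1 hγ)
  refine ⟨e.symm, e.symm.bijective, fun a => ?_⟩
  have h : f (z (μ (e.symm a))) = a := congrArg Subtype.val (e.apply_symm_apply a)
  rw [← h, hf.1]

/-- Sufficiency: under conditions (i)–(iii), some maximum matching of `G` is
uniquely restricted. -/
theorem stmt16 [Fintype V] (G : SimpleGraph V)
    (h1 : ∀ H : (G.induce (Cset G)).ConnectedComponent,
      ∃! N : Set (Sym2 ↥(compSet G (Cset G) H)),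
        IsPerfectMatchingSet (G.induce (compSet G (Cset G) H)) N)
    (h2 : ∃ MB, IsMaximumMatching (GB G) MB ∧ UniquelyRestricted (GB G) MB ∧
      ∀ e ∈ MB, ∃ (a : ↥(Aset G)) (H : DComp G) (h : V),
        e = s(Sum.inl a, Sum.inr H) ∧ h ∈ compSet G (Dset G) H ∧ G.Adj a.1 h ∧
        (∀ d ∈ compSet G (Dset G) H, G.Adj a.1 d → d = h) ∧
        UniquePMminus G (compSet G (Dset G) H) h)
    (h3 : ∀ H : DComp G, ∃ h ∈ compSet G (Dset G) H,
        UniquePMminus G (compSet G (Dset G) H) h) :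
    ∃ M, IsMaximumMatching G M ∧ UniquelyRestricted G M := by
  classical
  obtain ⟨MB, hMB, hUR, hMBform⟩ := h2
  have hrep : ∀ H : DComp G, ∃ h ∈ compSet G (Dset G) H,
      UniquePMminus G (compSet G (Dset G) H) h ∧
      ∀ a, s(Sum.inl a, Sum.inr H) ∈ MB →
        G.Adj a.1 h ∧ ∀ d ∈ compSet G (Dset G) H, G.Adj a.1 d → d = h := by
    intro H
    by_cases hH : ∃ a, s(Sum.inl a, Sum.inr H) ∈ MB
    · obtain ⟨a, ha⟩ := hH
      obtain ⟨a', H', h, he, hh, hadj, huniq, hPM⟩ := hMBform _ ha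
      rcases Sym2.eq_iff.1 he with ⟨h1, h2⟩ | ⟨h1, -⟩
      · cases h1; cases h2
        refine ⟨h, hh, hPM, fun b hb => ?_⟩
        obtain rfl : b = a := by
          by_contra hne
          refine hMB.1.2 _ ha _ hb (fun h => hne ?_) (Sum.inr H) (Sym2.mem_mk_right _ _)
            (Sym2.mem_mk_right _ _)
          exact (Sum.inl_injective (Sym2.congr_left.1 h)).symm
        exact ⟨hadj, huniq⟩
      · exact absurd h1 Sum.inl_ne_inr
    · obtain ⟨h, hh, hPM⟩ := h3 H
      exact ⟨h, hh, hPM, fun a ha => absurd ⟨a, ha⟩ hH⟩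
  choose r hr hrPM hrMB using hrep
  have hrinj := injective_of_mem_compSet hr
  have hrA : ∀ H, r H ∉ Aset G := fun H h => h.1 (mem_of_mem_compSet (hr H))
  have hexit : ∀ {f}, IsMatchingInvolution G f → ∃ z : DComp G → V,
      (∀ H, z H ∈ compSet G (Dset G) H) ∧ ∀ H, f (z H) = z H ∨ f (z H) ∈ Aset G := by
    intro f hf
    choose z hz hfz using fun H => hf.exists_mem_compSet_fixed_or_mem_Aset (hr H) (hrPM H)
    exact ⟨z, hz, hfz⟩
  obtain ⟨p, hp, hpfix, hpuniq⟩ := exists_near_perfect_involution h1 hr hrPM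
  have hMBcard : (Aset G).ncard ≤ MB.ncard := by
    obtain ⟨f, hf⟩ := exists_isOptimalInvolution G
    obtain ⟨z, hz, hfz⟩ := hexit hf.1
    obtain ⟨N, hN, hNcard⟩ := exists_isMatchingSet_GB hf.1 hz hfz
    have hle := hf.ncard_add_le_of_fixes_Aset hp fun x hx => (hpfix x).2 (Or.inl hx)
    have hpeq : Function.fixedPoints p = Aset G ∪ Set.range r := Set.ext hpfix
    have hle' := Set.ncard_union_le (Aset G) (Set.range r)
    rw [← hpeq, ← Set.image_univ (f := r), Set.ncard_image_of_injective _ hrinj,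
      Set.ncard_univ] at hle'
    have := hMB.2 N hN
    lia
  choose μ hμ using hMB.1.exists_partner_of_ncard_le
    (fun e he => (hMBform e he).imp fun a h => h.imp fun H h => h.choose_spec.1) hMBcard
  have hμinj : Function.Injective μ := by
    intro a b hab
    by_contra hne
    refine hMB.1.2 _ (hμ a) _ (hμ b) (fun h => hne ?_) (Sum.inr (μ a)) (Sym2.mem_mk_right _ _)
      (hab ▸ Sym2.mem_mk_right _ _)
    rw [hab] at h
    exact Sum.inl_injective (Sym2.congr_left.1 h)
  obtain ⟨F, hF, hFA, hFp, hFfix⟩ := exists_combined_involution hr hp hpfix hμinj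
    fun a => (hrMB _ a (hμ a)).1
  refine ⟨involutionEdges F, (isMaximumMatching_involutionEdges_iff hF).2
    ⟨hF, fun f hf => ?_⟩, fun M' hM' hverts => ?_⟩
  · obtain ⟨z, hz, hfz⟩ := hexit hf
    have hle := card_DComp_le hf.1 hz hfz
    have hsub : Function.fixedPoints F ⊆ r '' (Set.range μ)ᶜ := by
      intro x hx
      obtain ⟨H, hH, rfl⟩ := (hFfix x).1 hx
      exact ⟨H, hH, rfl⟩
    have h4 := (Set.ncard_le_ncard hsub).trans Set.ncard_image_le
    have h5 := Set.ncard_compl_add_ncard (Set.range μ)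
    rw [← Set.image_univ, Set.ncard_image_of_injective _ hμinj, Set.ncard_univ,
      Nat.card_coe_set_eq, Set.image_univ] at h5
    lia
  obtain ⟨f, hf, rfl⟩ := hM'.exists_involution
  have hsame : ∀ x, f x = x ↔ F x = x := fun x => by
    rw [← not_iff_not, ← ne_eq, ← ne_eq, ← mem_matVerts_involutionEdges hf.1,
      ← mem_matVerts_involutionEdges hF.1, hverts]
  obtain ⟨z, hz, hfz⟩ := hexit hf
  obtain ⟨β, hβ, hfβ⟩ := exists_partner_of_fixed_iff hr hμinj hf
    (fun x => (hsame x).trans (hFfix x)) hz hfz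
  have hfA_D : ∀ a : Aset G, f a ∈ compSet G (Dset G) (μ (β a)) := fun a => hfβ a ▸ hz _
  have hfA_adj : ∀ a : Aset G, G.Adj a (f a) := fun a =>
    hf.2 a fun h => a.2.1 (h ▸ mem_of_mem_compSet (hfA_D a))
  have hβid : ∀ a, β a = a := by
    have hMBeq : Set.range (fun a => s(Sum.inl a, Sum.inr (μ (β a)))) = MB := by
      refine hUR _ (isMatchingSet_range_mk Sum.inl_injective
        (Sum.inr_injective.comp (hμinj.comp hβ.1)) (fun _ _ => Sum.inl_ne_inr)
        fun a => GB_adj_inl_inr.2 ⟨f a, hfA_D a, hfA_adj a⟩) ?_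
      have hMBrange : MB = Set.range fun a => s(Sum.inl a, Sum.inr (μ a)) := by
        refine Set.Subset.antisymm (fun e he => ?_) ?_
        · obtain ⟨a, H, -, rfl, -⟩ := hMBform e he
          refine ⟨a, ?_⟩
          by_contra hne
          exact hMB.1.2 _ (hμ a) _ he hne (Sum.inl a) (Sym2.mem_mk_left _ _)
            (Sym2.mem_mk_left _ _)
        · rintro _ ⟨a, rfl⟩
          exact hμ a
      rw [hMBrange, matVerts_range_mk, matVerts_range_mk]
      congr 1
      exact hβ.2.range_comp fun a => Sum.inr (μ a)
    intro a
    by_contra hne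
    have hmem : s(Sum.inl a, Sum.inr (μ (β a))) ∈ MB := hMBeq ▸ ⟨a, rfl⟩
    refine hMB.1.2 _ hmem _ (hμ a) (fun h => hne ?_) (Sum.inl a) (Sym2.mem_mk_left _ _)
      (Sym2.mem_mk_left _ _)
    exact hμinj (Sum.inr_injective (Sym2.congr_right.1 h))
  have hfA : ∀ a : Aset G, f a = r (μ a) := fun a =>
    (hrMB _ a (hμ a)).2 _ (by simpa only [hβid a] using hfA_D a) (hfA_adj a)
  have hfr : ∀ a, f (r (μ a)) = a := fun a => by rw [← hfA a, hf.1]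
  have hnotA : ∀ x ∉ Aset G ∪ Set.range r, f x ∉ Aset G := fun x hx h =>
    hx (Or.inr ⟨μ ⟨f x, h⟩, by rw [← hfA ⟨f x, h⟩]; exact hf.1 x⟩)
  have hfp := hpuniq f hf (fun x hx => ?_) fun H x hx => ?_
  · congr 1
    funext x
    by_cases hxA : x ∈ Aset G
    · rw [hfA ⟨x, hxA⟩, hFA ⟨x, hxA⟩]
    by_cases hxr : x ∈ Set.range r
    · obtain ⟨H, rfl⟩ := hxr
      by_cases hH : H ∈ Set.range μ
      · obtain ⟨a, rfl⟩ := hH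
        rw [hfr, ← hFA a, hF.1]
      · have hfix := (hFfix (r H)).2 ⟨H, hH, rfl⟩
        rw [(hsame _).2 hfix, hfix]
    have hx : x ∉ Aset G ∪ Set.range r := fun h => h.elim hxA hxr
    rw [hfp x hx, hFp x hx]
  · have hx' : x ∉ Aset G ∪ Set.range r := by
      rintro (h | ⟨H, rfl⟩)
      · exact hx.2 h
      · exact hx.1 (mem_of_mem_compSet (hr H))
    have hne : f x ≠ x := fun h => by
      rw [hsame, hFp x hx', hpfix] at h
      exact hx' h
    exact ⟨⟨fun h => hx.2 ⟨hx.1, _, h, hf.2 x hne⟩, hnotA x hx'⟩, hne⟩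
  · have hx' : x ∉ Aset G ∪ Set.range r := by
      rintro (h | ⟨H', rfl⟩)
      · exact h.1 (mem_of_mem_compSet hx.1)
      · exact hx.2 (congrArg r (eq_of_mem_compSet (hr H') hx.1))
    have hne : f x ≠ x := fun h => by
      rw [hsame, hFp x hx', hpfix] at h
      exact hx' h
    have hD : f x ∈ Dset G := by
      by_contra h
      exact hnotA x hx' ⟨h, x, mem_of_mem_compSet hx.1, (hf.2 x hne).symm⟩
    refine ⟨⟨mem_compSet_of_adj hx.1 hD (hf.2 x hne), fun h => ?_⟩, hne⟩
    have hxr : f (r H) = x := by rw [← Set.mem_singleton_iff.1 h, hf.1]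
    by_cases hH : H ∈ Set.range μ
    · obtain ⟨a, rfl⟩ := hH
      exact hx' (Or.inl (hxr ▸ hfr a ▸ a.2))
    · have := (hsame _).2 ((hFfix (r H)).2 ⟨H, hH, rfl⟩)
      exact hx.2 (hxr.symm.trans this)
end
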